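/- Let n ≥ 1 and let X, Z be n×n complex matrices such that the matrix [X,Z] + Iₙ = XZ − ZX + Iₙ has rank 1. If X has only real eigenvalues and Z has only real eigenvalues, then there exists g ∈ GL_n(ℂ) such that both gXg⁻¹ and gZg⁻¹ have all entries real. -/

import Mathlib

/-- Partial fractions: here `t l` plays the role of `1 / (u - z l)` and `d l m` that of
`1 / (z l - z m)`. -/
theorem prod_sub_add_sum_mul_prod_erase {ι A : Type*} [DecidableEq ι] [CommRing A]
    (a : ι → A) (d : ι → ι → A) (hanti : ∀ i j, d i j = -d j i)
    (hd : ∀ i j k, i ≠ j → i ≠ k → j ≠ k → d i j * d i k = (d i j - d i k) * d j k)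
    (S : Finset ι) (t : ι → A)
    (ht : ∀ i ∈ S, ∀ m ∈ S, i ≠ m → t i * t m = (t i - t m) * d i m) :
    ∏ l ∈ S, (a l - t l) + ∑ i ∈ S, t i * ∏ l ∈ S.erase i, (a l - d i l) = ∏ l ∈ S, a l := by
  induction S using Finset.induction_on generalizing t with
  | empty => simp
  | insert m S hm ih =>
    have h1 := ih t fun i hi k hk => ht i (Finset.mem_insert_of_mem hi) k
      (Finset.mem_insert_of_mem hk)
    have hne : ∀ i ∈ S, m ≠ i := fun i hi h => hm (h ▸ hi)
    have h2 := ih (d m) fun i hi k hk hik => hd m i k (hne i hi) (hne k hk) hik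
    rw [Finset.prod_insert hm, Finset.prod_insert hm, Finset.sum_insert hm,
      Finset.erase_insert hm]
    have h3 : ∀ i ∈ S, t i * ∏ l ∈ (insert m S).erase i, (a l - d i l) =
        (a m * t i - t m * t i + t m * d m i) * ∏ l ∈ S.erase i, (a l - d i l) := by
      intro i hi
      rw [Finset.erase_insert_of_ne (hne i hi), Finset.prod_insert
        (fun h => hm (Finset.mem_of_mem_erase h))]
      have := ht i (Finset.mem_insert_of_mem hi) m (Finset.mem_insert_self _ _) (hne i hi).symm
      have h4 := hanti i m
      rw [h4] at this ⊢
      linear_combination (∏ l ∈ S.erase i, (a l - d i l)) * this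
    rw [Finset.sum_congr rfl h3]
    simp only [add_mul, sub_mul, Finset.sum_add_distrib, Finset.sum_sub_distrib, mul_assoc,
      ← Finset.mul_sum]
    linear_combination (a m - t m) * h1 + t m * h2

/-- The derivative of the partial fraction expansion `prod_sub_add_sum_mul_prod_erase`. -/
theorem sum_sq_mul_prod_erase_sub {ι A : Type*} [DecidableEq ι] [CommRing A]
    (a : ι → A) (d : ι → ι → A) (hanti : ∀ i j, d i j = -d j i)
    (hd : ∀ i j k, i ≠ j → i ≠ k → j ≠ k → d i j * d i k = (d i j - d i k) * d j k)
    (S : Finset ι) (t : ι → A)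
    (ht : ∀ i ∈ S, ∀ m ∈ S, i ≠ m → t i * t m = (t i - t m) * d i m) :
    ∑ i ∈ S, t i ^ 2 * ∏ l ∈ S.erase i, (a l - t l) =
      ∑ i ∈ S, t i ^ 2 * ∏ l ∈ S.erase i, (a l - d i l) := by
  induction S using Finset.induction_on with
  | empty => simp
  | insert m S hm ih =>
    have ht' : ∀ i ∈ S, ∀ k ∈ S, i ≠ k → t i * t k = (t i - t k) * d i k := fun i hi k hk =>
      ht i (Finset.mem_insert_of_mem hi) k (Finset.mem_insert_of_mem hk)
    have h0 := ih ht'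
    have hne : ∀ i ∈ S, m ≠ i := fun i hi h => hm (h ▸ hi)
    have h1 := prod_sub_add_sum_mul_prod_erase a d hanti hd S t ht'
    have h2 := prod_sub_add_sum_mul_prod_erase a d hanti hd S (d m)
      fun i hi k hk hik => hd m i k (hne i hi) (hne k hk) hik
    rw [Finset.sum_insert hm, Finset.sum_insert hm, Finset.erase_insert hm]
    have h3 : ∀ i ∈ S, t i ^ 2 * ∏ l ∈ (insert m S).erase i, (a l - t l) =
        (a m - t m) * (t i ^ 2 * ∏ l ∈ S.erase i, (a l - t l)) := by
      intro i hi
      rw [Finset.erase_insert_of_ne (hne i hi), Finset.prod_insert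
        (fun h => hm (Finset.mem_of_mem_erase h))]
      ring
    have h4 : ∀ i ∈ S, t i ^ 2 * ∏ l ∈ (insert m S).erase i, (a l - d i l) =
        (a m - t m) * (t i ^ 2 * ∏ l ∈ S.erase i, (a l - d i l)) +
        t m ^ 2 * (d m i * ∏ l ∈ S.erase i, (a l - d i l)) -
        t m ^ 2 * (t i * ∏ l ∈ S.erase i, (a l - d i l)) := by
      intro i hi
      rw [Finset.erase_insert_of_ne (hne i hi), Finset.prod_insert
        (fun h => hm (Finset.mem_of_mem_erase h))]
      have := ht i (Finset.mem_insert_of_mem hi) m (Finset.mem_insert_self _ _) (hne i hi).symm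
      have h4 := hanti i m
      rw [h4] at this ⊢
      linear_combination (∏ l ∈ S.erase i, (a l - d i l)) * (t i + t m) * this
    rw [Finset.sum_congr rfl h3, Finset.sum_congr rfl h4]
    simp only [Finset.sum_add_distrib, Finset.sum_sub_distrib, ← Finset.mul_sum]
    linear_combination (a m - t m) * h0 + t m ^ 2 * (h1 - h2)

section

open MvPolynomial

/-- Evaluation of polynomials at a family of pairwise commuting elements of a noncommutative
algebra. -/
theorem exists_algHom_of_commute {σ A : Type*} [Ring A] [Algebra ℂ A] (G : σ → A)
    (h : ∀ i j, Commute (G i) (G j)) :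
    ∃ Φ : MvPolynomial σ ℂ →ₐ[ℂ] A, ∀ i, Φ (X i) = G i := by
  let _ : CommRing (Algebra.adjoin ℂ (Set.range G)) :=
    { (Algebra.adjoin ℂ (Set.range G)).toRing with
      mul_comm := (Algebra.isMulCommutative_adjoin ℂ (s := Set.range G) (by
        rintro _ ⟨i, rfl⟩ _ ⟨j, rfl⟩
        exact h i j)).is_comm.comm }
  let G' : σ → Algebra.adjoin ℂ (Set.range G) := fun i =>
    ⟨G i, Algebra.subset_adjoin (Set.mem_range_self i)⟩
  exact ⟨(Algebra.adjoin ℂ (Set.range G)).val.comp (aeval G'), fun i => by simp [G']⟩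

section Gaudin

variable {ι : Type*} [Fintype ι] [DecidableEq ι]

/-- The Gaudin operators, acting on polynomials. -/
noncomputable def gaudin (c : ι → ι → ℂ) (i : ι) : Module.End ℂ (MvPolynomial ι ℂ) :=
  LinearMap.mulLeft ℂ (X i) - ∑ j, c i j • (rename (Equiv.swap i j)).toLinearMap

theorem gaudin_apply (c : ι → ι → ℂ) (i : ι) (h : MvPolynomial ι ℂ) :
    gaudin c i h = X i * h - ∑ j, c i j • rename (Equiv.swap i j) h := by
  simp [gaudin, LinearMap.sum_apply]

theorem sum_rename_swap_commutator (c : ι → ι → ℂ) (hanti : ∀ i j, c i j = -c j i)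
    (hc : ∀ i j k, i ≠ j → i ≠ k → j ≠ k → c i j * c i k = (c i j - c i k) * c j k)
    {i j : ι} (hij : i ≠ j) (h : MvPolynomial ι ℂ) :
    ∑ k, ∑ l, (c i k * c j l) • (rename (Equiv.swap i k * Equiv.swap j l : Equiv.Perm ι) h -
      rename (Equiv.swap j l * Equiv.swap i k : Equiv.Perm ι) h) = 0 := by
  have h0 : ∀ i, c i i = 0 := fun i => by
    have := hanti i i
    linear_combination this / 2
  set F : ι → ι → MvPolynomial ι ℂ := fun k l =>
    (c i k * c j l) • (rename (Equiv.swap i k * Equiv.swap j l : Equiv.Perm ι) h -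
      rename (Equiv.swap j l * Equiv.swap i k : Equiv.Perm ι) h) with hF
  have hFi : ∀ l, F i l = 0 := fun l => by simp [hF, h0]
  have hFj : ∀ k, F k j = 0 := fun k => by simp [hF, h0]
  have hFji : F j i = 0 := by simp [hF, Equiv.swap_comm j i]
  have hsplit : ∀ k l, F k l = (if l = i then F k i else 0) + (if k = j then F j l else 0) +
      (if k = l then F k k else 0) := by
    intro k l
    by_cases hki : k = i
    · subst hki; simp [hFi, hij]
    by_cases hlj : l = j
    · subst hlj
      by_cases hkl : k = l
      · subst hkl; simp [hFj, hij.symm]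
      · simp [hFj, hij.symm, hkl]
    by_cases hkj : k = j
    · subst hkj
      by_cases hli : l = i
      · subst hli; simp [hFji, hij.symm]
      · simp [hli, Ne.symm hlj]
    by_cases hli : l = i
    · subst hli; simp [hkj, hki]
    by_cases hkl : k = l
    · subst hkl; simp [hki, hkj]
    · have : Commute (Equiv.swap i k) (Equiv.swap j l) := by
        apply Equiv.Perm.Disjoint.commute
        rw [Equiv.Perm.disjoint_iff_disjoint_support, Equiv.Perm.support_swap (Ne.symm hki),
          Equiv.Perm.support_swap (Ne.symm hlj)]
        simp
        grind
      simp only [hkl, hkj, hli, if_false, add_zero]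
      simp only [hF]
      rw [this.eq, sub_self, smul_zero]
  have hcol : ∀ m, F m i + F j m + F m m = 0 := by
    intro m
    by_cases hmi : m = i
    · subst hmi; simp [hFi, hFji]
    by_cases hmj : m = j
    · subst hmj; simp [hFj, hFji]
    have e1 : Equiv.swap i m * Equiv.swap j i = Equiv.swap j m * Equiv.swap i m := by
      ext x; simp only [Equiv.Perm.mul_apply, Equiv.swap_apply_def]; grind
    have e2 : Equiv.swap i j * Equiv.swap j m = Equiv.swap j m * Equiv.swap i m := by
      ext x; simp only [Equiv.Perm.mul_apply, Equiv.swap_apply_def]; grind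
    have e3 : Equiv.swap j i * Equiv.swap i m = Equiv.swap i m * Equiv.swap j m := by
      ext x; simp only [Equiv.Perm.mul_apply, Equiv.swap_apply_def]; grind
    have e4 : Equiv.swap j m * Equiv.swap i j = Equiv.swap i m * Equiv.swap j m := by
      ext x; simp only [Equiv.Perm.mul_apply, Equiv.swap_apply_def]; grind
    simp only [hF]
    rw [e1, e2, e3, e4]
    have key : c i m * c j i + c i j * c j m - c i m * c j m = 0 := by
      have := hc i j m hij (Ne.symm hmi) (Ne.symm hmj)
      rw [hanti j i]
      linear_combination -this
    set P := rename (Equiv.swap j m * Equiv.swap i m : Equiv.Perm ι) h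
    set Q := rename (Equiv.swap i m * Equiv.swap j m : Equiv.Perm ι) h
    calc _ = (c i m * c j i + c i j * c j m - c i m * c j m) • (P - Q) := by module
      _ = 0 := by rw [key, zero_smul]
  calc ∑ k, ∑ l, F k l = ∑ m, (F m i + F j m + F m m) := by
        rw [Finset.sum_congr rfl fun k _ => Finset.sum_congr rfl fun l _ => hsplit k l]
        simp [Finset.sum_add_distrib]
    _ = 0 := Finset.sum_eq_zero fun m _ => hcol m

theorem gaudin_gaudin_apply (c : ι → ι → ℂ) {i j : ι} (hij : i ≠ j) (h : MvPolynomial ι ℂ) :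
    gaudin c i (gaudin c j h) = X i * X j * h - ∑ l, c j l • (X i * rename (Equiv.swap j l) h) -
      ∑ k, c i k • (X j * rename (Equiv.swap i k) h) -
      c i j • ((X i - X j) * rename (Equiv.swap i j) h) +
      ∑ k, ∑ l, (c i k * c j l) •
        rename (Equiv.swap i k * Equiv.swap j l : Equiv.Perm ι) h := by
  have h1 : ∀ k, rename (Equiv.swap i k) (X j * h) = X j * rename (Equiv.swap i k) h +
      if k = j then (X i - X j) * rename (Equiv.swap i j) h else 0 := by
    intro k
    rw [map_mul, rename_X]
    split_ifs with hk
    · subst hk; rw [Equiv.swap_apply_right]; ring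
    · rw [Equiv.swap_apply_of_ne_of_ne hij.symm (Ne.symm hk)]; ring
  have h2 : ∀ k l, rename (Equiv.swap i k) (rename (Equiv.swap j l) h) =
      rename (Equiv.swap i k * Equiv.swap j l : Equiv.Perm ι) h := fun k l => by
    rw [rename_rename]; rfl
  have h3 : ∀ k, rename (Equiv.swap i k) (gaudin c j h) = X j * rename (Equiv.swap i k) h +
      (if k = j then (X i - X j) * rename (Equiv.swap i j) h else 0) -
      ∑ l, c j l • rename (Equiv.swap i k * Equiv.swap j l : Equiv.Perm ι) h := fun k => by
    rw [gaudin_apply, map_sub, h1, map_sum]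
    simp only [map_smul, h2]
  have h4 : ∑ k, c i k • rename (Equiv.swap i k) (gaudin c j h) =
      ∑ k, c i k • (X j * rename (Equiv.swap i k) h) +
        c i j • ((X i - X j) * rename (Equiv.swap i j) h) -
        ∑ k, ∑ l, (c i k * c j l) •
          rename (Equiv.swap i k * Equiv.swap j l : Equiv.Perm ι) h := by
    simp only [h3, smul_sub, smul_add, Finset.sum_sub_distrib, Finset.sum_add_distrib, smul_ite,
      smul_zero, Finset.sum_ite_eq', Finset.mem_univ, if_true, Finset.smul_sum, smul_smul]
  rw [gaudin_apply, h4, gaudin_apply, mul_sub, Finset.mul_sum, ← mul_assoc]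
  simp only [mul_smul_comm]
  generalize ∑ k, ∑ l, (c i k * c j l) • rename (Equiv.swap i k * Equiv.swap j l : Equiv.Perm ι) h
    = A
  generalize ∑ k, c i k • (X j * rename (Equiv.swap i k) h) = B
  generalize ∑ l, c j l • (X i * rename (Equiv.swap j l) h) = D
  abel

theorem gaudin_commute (c : ι → ι → ℂ) (hanti : ∀ i j, c i j = -c j i)
    (hc : ∀ i j k, i ≠ j → i ≠ k → j ≠ k → c i j * c i k = (c i j - c i k) * c j k)
    (i j : ι) : Commute (gaudin c i) (gaudin c j) := by
  rcases eq_or_ne i j with rfl | hij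
  · exact Commute.refl _
  refine LinearMap.ext fun h => ?_
  rw [Module.End.mul_apply, Module.End.mul_apply, gaudin_gaudin_apply c hij,
    gaudin_gaudin_apply c hij.symm, hanti j i, Equiv.swap_comm j i,
    Finset.sum_comm (s := Finset.univ) (f := fun k l => (c j k * c i l) • _)]
  have := sum_rename_swap_commutator c hanti hc hij h
  simp only [smul_sub, Finset.sum_sub_distrib] at this
  rw [sub_eq_zero] at this
  rw [this]
  simp only [mul_comm (c j _) (c i _)]
  rw [mul_comm (X j) (X i)]
  have e : (-c i j) • ((X j - X i) * rename (Equiv.swap i j) h) =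
    c i j • ((X i - X j) * rename (Equiv.swap i j) h) := by
    rw [neg_smul, ← smul_neg, ← neg_mul, neg_sub]
  rw [e]
  abel

end Gaudin

end

section

open MvPolynomial

/-- An endomorphism that is unipotent with respect to an exhaustive filtration is bijective. -/
theorem bijective_of_filtration {R M : Type*} [Ring R] [AddCommGroup M] [Module R M]
    (W : ℕ → Submodule R M) (h0 : W 0 = ⊥) (hW : ∀ x, ∃ d, x ∈ W d) (T : M →ₗ[R] M)
    (hT : ∀ d, ∀ x ∈ W (d + 1), T x - x ∈ W d) : Function.Bijective T := by
  constructor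
  · rw [← LinearMap.ker_eq_bot, LinearMap.ker_eq_bot']
    intro x hx
    have key : ∀ d, x ∈ W d → x = 0 := by
      intro d
      induction d with
      | zero => intro h; simpa [h0] using h
      | succ d ih =>
        intro h
        have := hT d x h
        rw [hx, zero_sub, neg_mem_iff] at this
        exact ih this
    obtain ⟨d, hd⟩ := hW x
    exact key d hd
  · have key : ∀ d, W d ≤ LinearMap.range T := by
      intro d
      induction d with
      | zero => simp [h0]
      | succ d ih =>
        intro x hx
        have h1 := ih (hT d x hx)
        have h2 := sub_mem (LinearMap.mem_range_self T x) h1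
        rwa [sub_sub_cancel] at h2
    intro x
    obtain ⟨d, hd⟩ := hW x
    exact key d hd

section

variable {ι : Type*} [Fintype ι] [DecidableEq ι]

theorem gaudin_orbit_bijective (c : ι → ι → ℂ)
    (Φ : MvPolynomial ι ℂ →ₐ[ℂ] Module.End ℂ (MvPolynomial ι ℂ))
    (hΦ : ∀ i, Φ (X i) = gaudin c i) : Function.Bijective fun q => Φ q 1 := by
  let T : MvPolynomial ι ℂ →ₗ[ℂ] MvPolynomial ι ℂ := LinearMap.applyₗ 1 ∘ₗ Φ.toLinearMap
  let W : ℕ → Submodule ℂ (MvPolynomial ι ℂ) := fun d => restrictSupport ℂ {m | m.degree < d}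
  have hWmono : ∀ d, W d ≤ W (d + 1) := fun d =>
    restrictSupport_mono _ fun m (hm : m.degree < d) => Nat.lt_succ_of_lt hm
  have hWX : ∀ d i q, q ∈ W d → X i * q ∈ W (d + 1) := by
    intro d i q hq
    simp only [W, mem_restrictSupport_iff] at hq ⊢
    intro m hm
    rw [Finset.mem_coe, support_X_mul, Finset.mem_map] at hm
    obtain ⟨m', hm', rfl⟩ := hm
    have := hq hm'
    simp at this ⊢
    omega
  have hWr : ∀ d (e : Equiv.Perm ι) q, q ∈ W d → rename e q ∈ W d := by
    intro d e q hq
    simp only [W, mem_restrictSupport_iff] at hq ⊢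
    intro m hm
    rw [Finset.mem_coe, support_rename_of_injective e.injective, Finset.mem_image] at hm
    obtain ⟨m', hm', rfl⟩ := hm
    have := hq hm'
    simpa [Finsupp.degree_mapDomain] using this
  have hX : ∀ i q, T (X i * q) - X i * q = X i * (T q - q) -
      ∑ j, c i j • rename (Equiv.swap i j) (q + (T q - q)) := by
    intro i q
    have : T (X i * q) = gaudin c i (T q) := by simp [T, hΦ]
    rw [this, gaudin_apply, add_sub_cancel]
    ring
  have hmon : ∀ d (m : ι →₀ ℕ), m.degree = d → ∀ a : ℂ, T (monomial m a) - monomial m a ∈ W d := by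
    intro d
    induction d with
    | zero =>
      intro m hm a
      rw [Finsupp.degree_eq_zero_iff] at hm
      have : T (monomial m a) - monomial m a = 0 := by
        have h1 : monomial m a = algebraMap ℂ (MvPolynomial ι ℂ) a := by subst hm; rfl
        have h2 : Φ (algebraMap ℂ (MvPolynomial ι ℂ) a) = algebraMap ℂ _ a := Φ.commutes a
        rw [h1, sub_eq_zero]
        simp only [T, LinearMap.comp_apply, AlgHom.toLinearMap_apply, LinearMap.applyₗ_apply_apply,
          h2, Module.algebraMap_end_apply]
        rw [Algebra.algebraMap_eq_smul_one]
      rw [this]; exact zero_mem _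
    | succ d ih =>
      intro m hm a
      obtain ⟨i, hi⟩ : ∃ i, m i ≠ 0 := by
        by_contra! h
        have : m = 0 := Finsupp.ext h
        simp [this] at hm
      obtain ⟨m', rfl⟩ : ∃ m', m = Finsupp.single i 1 + m' :=
        ⟨m - Finsupp.single i 1, (add_tsub_cancel_of_le (by
          simpa [Nat.one_le_iff_ne_zero] using hi)).symm⟩
      have hm' : m'.degree = d := by
        rw [map_add, Finsupp.degree_single] at hm
        omega
      have hN := ih m' hm' a
      have e : monomial (Finsupp.single i 1 + m') a = X i * monomial m' a := by
        rw [X, monomial_mul, one_mul]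
      rw [e, hX]
      refine sub_mem (hWX _ _ _ hN) (sum_mem fun j _ => Submodule.smul_mem _ _ (hWr _ _ _ ?_))
      refine add_mem ?_ (hWmono _ hN)
      refine (monomial_mem_restrictSupport _).2 (Or.inl ?_)
      simp [hm']
  refine bijective_of_filtration W ?_ ?_ T ?_
  · simp [W, restrictSupport_eq_span]
  · intro x
    refine ⟨x.totalDegree + 1, ?_⟩
    simp only [W, mem_restrictSupport_iff]
    intro m hm
    have := le_totalDegree hm
    simp [Finsupp.degree, Finsupp.sum] at this ⊢
    omega
  · intro d x hx
    rw [x.as_sum, map_sum, ← Finset.sum_sub_distrib]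
    refine sum_mem fun m hm => ?_
    refine restrictSupport_mono _ ?_ (hmon _ m rfl _)
    intro k hk
    have := (mem_restrictSupport_iff _).1 hx hm
    simp only [Set.mem_ofPred_eq] at this hk ⊢
    omega

theorem sum_pow_apply_one (c : ι → ι → ℂ)
    (Φ : MvPolynomial ι ℂ →ₐ[ℂ] Module.End ℂ (MvPolynomial ι ℂ))
    (hΦ : ∀ i, Φ (X i) = gaudin c i) (k : ℕ) (i : ι) :
    ∑ j, Φ (((Matrix.diagonal X + Matrix.of fun i j => C (c i j) :
      Matrix ι ι (MvPolynomial ι ℂ)) ^ k) i j) 1 = X i ^ k := by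
  set Y : Matrix ι ι (MvPolynomial ι ℂ) := Matrix.diagonal X + Matrix.of fun i j => C (c i j)
    with hY
  have hC : ∀ a : ℂ, ∀ h, Φ (C a) h = a • h := fun a h => by
    have : Φ (algebraMap ℂ (MvPolynomial ι ℂ) a) = algebraMap ℂ _ a := Φ.commutes a
    rw [← algebraMap_eq, this, Module.algebraMap_end_apply]
  induction k generalizing i with
  | zero => simp [Matrix.one_apply, apply_ite Φ, apply_ite DFunLike.coe, ite_apply]
  | succ k ih =>
    have h1 : ∀ l, Φ (Y i l) (X l ^ k) = (if i = l then gaudin c i (X i ^ k) else 0) +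
        c i l • X l ^ k := by
      intro l
      rw [hY, Matrix.add_apply, map_add, LinearMap.add_apply, Matrix.of_apply, hC]
      congr 1
      split_ifs with h
      · subst h; simp [hΦ]
      · simp [Matrix.diagonal_apply_ne _ h]
    calc ∑ j, Φ ((Y ^ (k + 1)) i j) 1 = ∑ l, Φ (Y i l) (∑ j, Φ ((Y ^ k) l j) 1) := by
          simp only [pow_succ', Matrix.mul_apply, map_sum, map_mul, LinearMap.sum_apply,
            Module.End.mul_apply]
          exact Finset.sum_comm
      _ = X i ^ (k + 1) := by
          simp only [ih, h1, Finset.sum_add_distrib, Finset.sum_ite_eq, Finset.mem_univ, if_true,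
            gaudin_apply, map_pow, rename_X, Equiv.swap_apply_left]
          ring

/-- A matrix `Y` with `[diag x, Y] + 1` the all-ones matrix. -/
theorem trace_pow_eq_sum {R : Type*} [CommRing R] (x : ι → R) (Y : Matrix ι ι R)
    (hY : ∀ i j, i ≠ j → (x i - x j) * Y i j = 1) (k : ℕ) :
    (Y ^ k).trace = ∑ i, ∑ j, (Y ^ k) i j := by
  have h1 : Matrix.diagonal x * Y - Y * Matrix.diagonal x + 1 = Matrix.of fun _ _ => 1 := by
    ext i j
    rcases eq_or_ne i j with rfl | h
    · simp [mul_comm]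
    · have := hY i j h
      simp [h]
      linear_combination this
  have h2 : (Y ^ k * (Matrix.diagonal x * Y - Y * Matrix.diagonal x)).trace = 0 := by
    rw [mul_sub, Matrix.trace_sub, ← mul_assoc, Matrix.trace_mul_comm (Y ^ k * Matrix.diagonal x),
      ← mul_assoc, ← mul_assoc, ← pow_succ', ← pow_succ, sub_self]
  calc (Y ^ k).trace = (Y ^ k * Matrix.of fun _ _ => 1).trace := by
        rw [← h1, mul_add, Matrix.trace_add, h2, mul_one, zero_add]
    _ = _ := by simp [Matrix.trace, Matrix.mul_apply]

theorem gaudin_symmetric_mul (c : ι → ι → ℂ) (i : ι) {s : MvPolynomial ι ℂ} (hs : s.IsSymmetric)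
    (h : MvPolynomial ι ℂ) : gaudin c i (s * h) = s * gaudin c i h := by
  simp only [gaudin_apply, map_mul, hs _, mul_sub, Finset.mul_sum, mul_smul_comm]
  ring

theorem exists_functional {z : ι → ℂ} (hz : Function.Injective z) (p : ι → ℂ) :
    ∃ ε : MvPolynomial ι ℂ →ₗ[ℂ] ℂ, ε 1 = 1 ∧
      (∀ i h, ε (gaudin (fun i j => (z i - z j)⁻¹) i h) = p i * ε h) ∧
      ∀ k h, ε (psum ι ℂ k * h) =
        ((Matrix.diagonal p + Matrix.of fun i j => (z i - z j)⁻¹) ^ k).trace * ε h := by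
  set c : ι → ι → ℂ := fun i j => (z i - z j)⁻¹ with hc
  have hne : ∀ i j, i ≠ j → z i - z j ≠ 0 := fun i j h => sub_ne_zero.2 (hz.ne h)
  have hcomm : ∀ i j, Commute (gaudin c i) (gaudin c j) := by
    refine gaudin_commute c (fun i j => ?_) (fun i j k hij hik hjk => ?_)
    · simp only [hc, ← neg_sub (z j) (z i), inv_neg]
    · have h1 := hne _ _ hij
      have h2 := hne _ _ hik
      have h3 := hne _ _ hjk
      simp only [hc]
      field_simp
      ring
  obtain ⟨Φ, hΦ⟩ := exists_algHom_of_commute (gaudin c) hcomm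
  let T : MvPolynomial ι ℂ →ₗ[ℂ] MvPolynomial ι ℂ := LinearMap.applyₗ 1 ∘ₗ Φ.toLinearMap
  let Θ := LinearEquiv.ofBijective T (gaudin_orbit_bijective c Φ hΦ)
  let ε : MvPolynomial ι ℂ →ₗ[ℂ] ℂ := (aeval p).toLinearMap ∘ₗ Θ.symm.toLinearMap
  have hε : ∀ q, ε (Φ q 1) = aeval p q := fun q => by
    have : Θ.symm (Φ q 1) = q := Θ.symm_apply_apply q
    simp [ε, this]
  have hsurj : ∀ h, ∃ q, Φ q 1 = h := (gaudin_orbit_bijective c Φ hΦ).2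
  refine ⟨ε, ?_, ?_, ?_⟩
  · simpa using hε 1
  · intro i h
    obtain ⟨q, rfl⟩ := hsurj h
    have : gaudin c i (Φ q 1) = Φ (X i * q) 1 := by rw [map_mul, hΦ]; rfl
    rw [this, hε, hε]; simp
  · intro k h
    obtain ⟨q, rfl⟩ := hsurj h
    set Y : Matrix ι ι (MvPolynomial ι ℂ) := Matrix.diagonal X + Matrix.of fun i j => C (c i j)
      with hY
    have h1 : psum ι ℂ k = Φ (Y ^ k).trace 1 := by
      rw [trace_pow_eq_sum (fun i => C (z i)) Y]
      · simp only [map_sum, LinearMap.sum_apply]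
        simp only [hY, sum_pow_apply_one c Φ hΦ k, psum]
      · intro i j hij
        rw [hY, Matrix.add_apply, Matrix.diagonal_apply_ne _ hij, zero_add, Matrix.of_apply,
          ← C_sub, ← C_mul, hc, mul_inv_cancel₀ (hne i j hij), C_1]
    have h2 : ∀ q h, Φ q (psum ι ℂ k * h) = psum ι ℂ k * Φ q h := by
      intro q
      induction q using MvPolynomial.induction_on with
      | C a =>
        intro h
        have : Φ (algebraMap ℂ (MvPolynomial ι ℂ) a) = algebraMap ℂ _ a := Φ.commutes a
        rw [← algebraMap_eq, this]
        simp
      | add q r hq hr => intro h; simp [hq, hr, mul_add]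
      | mul_X q i hq =>
        intro h
        simp only [map_mul Φ, Module.End.mul_apply, hΦ,
          gaudin_symmetric_mul c i (psum_isSymmetric ι ℂ k), hq]
    have h3 : psum ι ℂ k * Φ q 1 = Φ (q * (Y ^ k).trace) 1 := by
      rw [← h2, mul_one, map_mul, Module.End.mul_apply, ← h1]
    rw [h3, hε, hε, map_mul, mul_comm]
    congr 1
    have h4 : (aeval p : MvPolynomial ι ℂ →ₐ[ℂ] ℂ).mapMatrix Y =
        Matrix.diagonal p + Matrix.of c := by
      ext i j
      simp [hY, Matrix.diagonal_apply, apply_ite]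
    have h5 : Matrix.of c = Matrix.of fun i j => (z i - z j)⁻¹ := rfl
    rw [← h5, ← h4, ← map_pow]
    simp [Matrix.trace]

end

end

section

open MvPolynomial

section

variable {ι : Type*} [Fintype ι]

theorem functional_esymm_mul (ε : MvPolynomial ι ℂ →ₗ[ℂ] ℂ) (lam : ι → ℂ)
    (hε : ∀ k h, ε (psum ι ℂ k * h) = aeval lam (psum ι ℂ k) * ε h) (k : ℕ)
    (h : MvPolynomial ι ℂ) :
    ε (esymm ι ℂ k * h) = aeval lam (esymm ι ℂ k) * ε h := by
  let A : Subalgebra ℂ (MvPolynomial ι ℂ) :=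
    { carrier := {s | ∀ h, ε (s * h) = aeval lam s * ε h}
      mul_mem' := fun {s t} hs ht h => by rw [mul_assoc, hs, ht, map_mul, mul_assoc]
      add_mem' := fun {s t} hs ht h => by rw [add_mul, map_add, hs, ht, map_add, add_mul]
      algebraMap_mem' := fun a h => by
        rw [← Algebra.smul_def, map_smul, AlgHom.commutes]; rfl }
  suffices H : esymm ι ℂ k ∈ A from H h
  have hp : ∀ k, psum ι ℂ k ∈ A := hε
  clear h
  induction k using Nat.strong_induction_on with
  | _ k ih =>
    rcases Nat.eq_zero_or_pos k with rfl | hk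
    · rw [esymm_zero]; exact one_mem A
    · have hN := mul_esymm_eq_sum ι ℂ k
      have e : esymm ι ℂ k = (k : ℂ)⁻¹ • ((-1) ^ (k + 1) *
          ∑ a ∈ Finset.HasAntidiagonal.antidiagonal k with a.1 < k,
            (-1) ^ a.1 * esymm ι ℂ a.1 * psum ι ℂ a.2) := by
        rw [← hN, ← nsmul_eq_mul, ← Nat.cast_smul_eq_nsmul ℂ, smul_smul,
          inv_mul_cancel₀ (Nat.cast_ne_zero.2 hk.ne'), one_smul]
      rw [e]
      have h1 : (-1 : MvPolynomial ι ℂ) ∈ A := neg_mem (one_mem A)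
      refine A.smul_mem (mul_mem (pow_mem h1 _) (sum_mem fun a ha => ?_)) _
      exact mul_mem (mul_mem (pow_mem h1 _) (ih _ (Finset.mem_filter.1 ha).2)) (hp _)

theorem prod_sub_eq_sum_esymm {R : Type*} [CommRing R] [Algebra ℂ R] (f : ι → R) (t : R) :
    ∏ i, (t - f i) = ∑ j ∈ Finset.range (Fintype.card ι + 1),
      (-1) ^ j * (aeval f (esymm ι ℂ j) * t ^ (Fintype.card ι - j)) := by
  have := congrArg (Polynomial.eval t)
    (Multiset.prod_X_sub_X_eq_sum_esymm (Finset.univ.val.map f))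
  simp only [Multiset.map_map, Multiset.card_map, Finset.card_val, Finset.card_univ,
    Polynomial.eval_finsetSum, Polynomial.eval_mul, Polynomial.eval_pow, Polynomial.eval_neg,
    Polynomial.eval_one, Polynomial.eval_C, Polynomial.eval_X] at this
  simp only [aeval_esymm_eq_multiset_esymm]
  rw [← this, Polynomial.eval_multiset_prod, Multiset.map_map]
  simp [Function.comp_def]

theorem functional_prod_mul (ε : MvPolynomial ι ℂ →ₗ[ℂ] ℂ) (lam : ι → ℂ)
    (hε : ∀ k h, ε (psum ι ℂ k * h) = aeval lam (psum ι ℂ k) * ε h) (t h : MvPolynomial ι ℂ) :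
    ε ((∏ k, (t - X k)) * h) = ε ((∏ k, (t - C (lam k))) * h) := by
  rw [prod_sub_eq_sum_esymm, prod_sub_eq_sum_esymm, Finset.sum_mul, Finset.sum_mul, map_sum,
    map_sum]
  refine Finset.sum_congr rfl fun j _ => ?_
  have e1 : aeval (X : ι → MvPolynomial ι ℂ) (esymm ι ℂ j) = esymm ι ℂ j := by simp
  have e2 : aeval (fun k => C (lam k) : ι → MvPolynomial ι ℂ) (esymm ι ℂ j) =
      algebraMap ℂ _ (aeval lam (esymm ι ℂ j)) := by
    rw [← aeval_algebraMap_apply]; rfl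
  have e3 : ((-1) ^ j : MvPolynomial ι ℂ) * (esymm ι ℂ j * t ^ (Fintype.card ι - j)) * h =
    esymm ι ℂ j * ((-1) ^ j * t ^ (Fintype.card ι - j) * h) := by ring
  have e4 : ((-1) ^ j : MvPolynomial ι ℂ) * (algebraMap ℂ _ (aeval lam (esymm ι ℂ j)) *
      t ^ (Fintype.card ι - j)) * h =
      aeval lam (esymm ι ℂ j) • ((-1) ^ j * t ^ (Fintype.card ι - j) * h) := by
    rw [Algebra.smul_def]; ring
  rw [e1, e2, e3, e4, functional_esymm_mul ε lam hε, map_smul, smul_eq_mul]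

variable [DecidableEq ι]

/-- The Lagrange polynomial that is `1` at `lam ∘ v` and vanishes at `lam ∘ v'` for `v' ≠ v`. -/
noncomputable def lagrangeProd (lam : ι → ℂ) (v : ι → ι) : MvPolynomial ι ℂ :=
  ∏ i, Polynomial.aeval (X i) (Lagrange.basis Finset.univ lam (v i))

theorem sum_lagrangeProd [Nonempty ι] {lam : ι → ℂ} (hlam : Function.Injective lam) :
    ∑ v, lagrangeProd lam v = 1 := by
  simp only [lagrangeProd]
  rw [← Fintype.piFinset_univ, ← Finset.prod_univ_sum (fun _ => Finset.univ)
    (fun i k => Polynomial.aeval (X i : MvPolynomial ι ℂ) (Lagrange.basis Finset.univ lam k))]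
  refine Finset.prod_eq_one fun i _ => ?_
  rw [← map_sum, Lagrange.sum_basis hlam.injOn Finset.univ_nonempty, map_one]

theorem aeval_lagrangeProd {lam : ι → ℂ} (hlam : Function.Injective lam) (v w : ι → ι) :
    aeval (lam ∘ w) (lagrangeProd lam v) = if w = v then 1 else 0 := by
  have h1 : aeval (lam ∘ w) (lagrangeProd lam v) =
      ∏ i, (Lagrange.basis Finset.univ lam (v i)).eval (lam (w i)) := by
    simp only [lagrangeProd, map_prod, ← Polynomial.aeval_algHom_apply, aeval_X,
      Function.comp_apply, Polynomial.coe_aeval_eq_eval]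
  rw [h1]
  split_ifs with h
  · subst h
    exact Finset.prod_eq_one fun i _ => Lagrange.eval_basis_self hlam.injOn (Finset.mem_univ _)
  · obtain ⟨i, hi⟩ := Function.ne_iff.1 h
    exact Finset.prod_eq_zero (Finset.mem_univ i)
      (Lagrange.eval_basis_of_ne (Ne.symm hi) (Finset.mem_univ _))

theorem sub_mul_lagrangeBasis (lam : ι → ℂ) (k : ι) (R : Type*) [CommRing R] [Algebra ℂ R] (x : R) :
    ∃ a : ℂ, (x - algebraMap ℂ R (lam k)) *
      Polynomial.aeval x (Lagrange.basis Finset.univ lam k) =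
        a • ∏ m, (x - algebraMap ℂ R (lam m)) := by
  refine ⟨∏ m ∈ Finset.univ.erase k, (lam k - lam m)⁻¹, ?_⟩
  rw [← Finset.mul_prod_erase Finset.univ _ (Finset.mem_univ k), Lagrange.basis, map_prod,
    ← mul_smul_comm]
  congr 1
  simp only [Lagrange.basisDivisor, map_mul, Polynomial.aeval_C, map_sub, Polynomial.aeval_X,
    ← Algebra.smul_def, Finset.prod_smul]

theorem functional_mul_lagrangeProd (ε : MvPolynomial ι ℂ →ₗ[ℂ] ℂ) (lam : ι → ℂ)
    (hε : ∀ k h, ε (psum ι ℂ k * h) = aeval lam (psum ι ℂ k) * ε h) (v : ι → ι)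
    (h : MvPolynomial ι ℂ) :
    ε (h * lagrangeProd lam v) = aeval (lam ∘ v) h * ε (lagrangeProd lam v) := by
  have hX : ∀ i g, ε (g * X i * lagrangeProd lam v) = lam (v i) * ε (g * lagrangeProd lam v) := by
    intro i g
    obtain ⟨a, ha⟩ := sub_mul_lagrangeBasis lam (v i) (MvPolynomial ι ℂ) (X i)
    rw [algebraMap_eq] at ha
    have h1 : g * X i * lagrangeProd lam v - lam (v i) • (g * lagrangeProd lam v) =
        (∏ m, (X i - C (lam m))) * (a • g * ∏ j ∈ Finset.univ.erase i,
          Polynomial.aeval (X j) (Lagrange.basis Finset.univ lam (v j))) := by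
      rw [lagrangeProd, ← Finset.mul_prod_erase Finset.univ _ (Finset.mem_univ i),
        smul_eq_C_mul, smul_eq_C_mul]
      rw [smul_eq_C_mul] at ha
      linear_combination (g * ∏ j ∈ Finset.univ.erase i,
        Polynomial.aeval (X j) (Lagrange.basis Finset.univ lam (v j))) * ha
    have h2 : ε (g * X i * lagrangeProd lam v - lam (v i) • (g * lagrangeProd lam v)) = 0 := by
      rw [h1, ← functional_prod_mul ε lam hε,
        Finset.prod_eq_zero (Finset.mem_univ i) (sub_self _), zero_mul, map_zero]
    rwa [map_sub, map_smul, smul_eq_mul, sub_eq_zero] at h2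
  induction h using MvPolynomial.induction_on with
  | C a => rw [← smul_eq_C_mul, map_smul, aeval_C]; rfl
  | add p q hp hq => rw [add_mul, map_add, hp, hq, map_add, add_mul]
  | mul_X p i hp => rw [hX, hp, map_mul, aeval_X, Function.comp_apply]; ring

theorem functional_eq_sum_perm [Nonempty ι] (ε : MvPolynomial ι ℂ →ₗ[ℂ] ℂ) {lam : ι → ℂ}
    (hlam : Function.Injective lam)
    (hε : ∀ k h, ε (psum ι ℂ k * h) = aeval lam (psum ι ℂ k) * ε h) :
    ∃ ψ : Equiv.Perm ι → ℂ, ∀ h, ε h = ∑ w : Equiv.Perm ι, ψ w * aeval (lam ∘ w) h := by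
  refine ⟨fun w => ε (lagrangeProd lam w), fun h => ?_⟩
  have h1 : ε h = ∑ v, ε (lagrangeProd lam v) * aeval (lam ∘ v) h := by
    conv_lhs => rw [← mul_one h, ← sum_lagrangeProd hlam, Finset.mul_sum, map_sum]
    exact Finset.sum_congr rfl fun v _ => by rw [functional_mul_lagrangeProd ε lam hε, mul_comm]
  have h2 : ∀ v : ι → ι, ¬ Function.Surjective v → ε (lagrangeProd lam v) = 0 := by
    intro v hv
    obtain ⟨k, hk⟩ := not_forall.1 hv
    have h3 := functional_prod_mul ε lam hε (C (lam k)) (lagrangeProd lam v)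
    rw [Finset.prod_eq_zero (f := fun m => C (lam k) - C (lam m)) (Finset.mem_univ k) (sub_self _),
      zero_mul, map_zero, functional_mul_lagrangeProd ε lam hε] at h3
    refine (mul_eq_zero.1 h3).resolve_left ?_
    simp only [map_prod, map_sub, aeval_C, aeval_X, Function.comp_apply]
    exact Finset.prod_ne_zero_iff.2 fun i _ => sub_ne_zero.2 (hlam.ne fun e => hk ⟨i, e.symm⟩)
  rw [h1]
  symm
  refine Finset.sum_of_injOn (fun w : Equiv.Perm ι => (w : ι → ι))
    (Equiv.coe_fn_injective.injOn) (by simp) ?_ (fun _ _ => rfl)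
  intro v _ hv
  rw [h2 v, zero_mul]
  intro hs
  exact hv ⟨Equiv.ofBijective v hs.bijective_of_finite, by simp, rfl⟩

end

end

section

variable {ι : Type*} [Fintype ι] [DecidableEq ι]

/-- The resolvents of the Gaudin operators, as matrices indexed by permutations. -/
def resolventMatrix (c : ι → ι → ℂ) (y : ι → ℂ) (j : ι) :
    Matrix (Equiv.Perm ι) (Equiv.Perm ι) ℂ :=
  Matrix.of fun w w' => ∏ i ∈ Finset.univ.erase j, ((if w i = w' i then y (w i) else 0) - c j i)

theorem resolventMatrix_mul_swap (c : ι → ι → ℂ) (y : ι → ℂ) {j k : ι} (hk : k ≠ j)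
    (w w' : Equiv.Perm ι) :
    resolventMatrix c y j (w * Equiv.swap j k) w' =
      ((if w j = w' k then y (w j) else 0) - c j k) *
        ∏ l ∈ (Finset.univ.erase j).erase k, ((if w l = w' l then y (w l) else 0) - c j l) := by
  rw [resolventMatrix, Matrix.of_apply,
    ← Finset.mul_prod_erase _ _ (Finset.mem_erase.2 ⟨hk, Finset.mem_univ k⟩)]
  congr 1
  · simp
  · refine Finset.prod_congr rfl fun l hl => ?_
    simp only [Finset.mem_erase] at hl
    rw [Equiv.Perm.mul_apply, Equiv.swap_apply_of_ne_of_ne hl.2.1 hl.1]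

theorem resolventMatrix_identity (c : ι → ι → ℂ) (hanti : ∀ i j, c i j = -c j i)
    (hc : ∀ i j k, i ≠ j → i ≠ k → j ≠ k → c i j * c i k = (c i j - c i k) * c j k)
    (y : ι → ℂ) (j : ι) (w w' : Equiv.Perm ι) :
    y (w j) * resolventMatrix c y j w w' +
      ∑ k, c j k * resolventMatrix c y j (w * Equiv.swap j k) w' -
      ∑ i, c i j * resolventMatrix c y i w w' = if w = w' then ∏ i, y i else 0 := by
  have h0 : ∀ i, c i i = 0 := fun i => by linear_combination hanti i i / 2
  set a : ι → ℂ := fun l => if w l = w' l then y (w l) else 0 with ha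
  set S := Finset.univ.erase j with hS
  have hjS : ∀ k ∈ S, k ≠ j := fun k hk => (Finset.mem_erase.1 hk).1
  have ht : ∀ i ∈ S, ∀ m ∈ S, i ≠ m → c j i * c j m = (c j i - c j m) * c i m :=
    fun i hi m hm him => hc j i m (hjS i hi).symm (hjS m hm).symm him
  have pf := prod_sub_add_sum_mul_prod_erase a c hanti hc S (c j) ht
  have pf' := sum_sq_mul_prod_erase_sub a c hanti hc S (c j) ht
  have hR : resolventMatrix c y j w w' = ∏ l ∈ S, (a l - c j l) := rfl
  have e1 : ∑ k, c j k * resolventMatrix c y j (w * Equiv.swap j k) w' =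
      ∑ k ∈ S, c j k * (if w j = w' k then y (w j) else 0) * ∏ l ∈ S.erase k, (a l - c j l) -
      ∑ k ∈ S, c j k ^ 2 * ∏ l ∈ S.erase k, (a l - c j l) := by
    rw [← Finset.add_sum_erase _ _ (Finset.mem_univ j), h0, zero_mul, zero_add,
      ← Finset.sum_sub_distrib]
    refine Finset.sum_congr rfl fun k hk => ?_
    rw [resolventMatrix_mul_swap c y (hjS k hk)]
    ring
  have e2 : ∑ i, c i j * resolventMatrix c y i w w' =
      -(a j * ∑ i ∈ S, c j i * ∏ l ∈ S.erase i, (a l - c i l)) -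
        ∑ i ∈ S, c j i ^ 2 * ∏ l ∈ S.erase i, (a l - c i l) := by
    rw [← Finset.add_sum_erase _ _ (Finset.mem_univ j), h0, zero_mul, zero_add, Finset.mul_sum,
      ← Finset.sum_neg_distrib, ← Finset.sum_sub_distrib]
    refine Finset.sum_congr rfl fun i hi => ?_
    have : resolventMatrix c y i w w' = (a j - c i j) * ∏ l ∈ S.erase i, (a l - c i l) := by
      rw [resolventMatrix, Matrix.of_apply, hS, Finset.erase_right_comm,
        ← Finset.mul_prod_erase _ _ (Finset.mem_erase.2 ⟨(hjS i hi).symm, Finset.mem_univ j⟩)]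
    rw [this, hanti i j]
    ring
  have e3 : (if w = w' then ∏ i, y i else 0) = a j * ∏ l ∈ S, a l := by
    rw [hS, Finset.mul_prod_erase _ _ (Finset.mem_univ j)]
    split_ifs with h
    · subst h
      simp [ha, Equiv.prod_comp w y]
    · obtain ⟨i, hi⟩ := not_forall.1 fun h' => h (Equiv.ext h')
      exact (Finset.prod_eq_zero (Finset.mem_univ i) (if_neg hi)).symm
  rw [hR, e1, e2, e3, ← pf, pf']
  by_cases hj : w j = w' j
  · have h1 : ∑ k ∈ S, c j k * (if w j = w' k then y (w j) else 0) *
        ∏ l ∈ S.erase k, (a l - c j l) = 0 := by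
      refine Finset.sum_eq_zero fun k hk => ?_
      rw [if_neg, mul_zero, zero_mul]
      rw [hj]
      exact fun h => hjS k hk (w'.injective h).symm
    have h2 : a j = y (w j) := if_pos hj
    rw [h1, h2]
    ring
  · have h2 : a j = 0 := if_neg hj
    obtain ⟨m, hm⟩ := w'.surjective (w j)
    have hmj : m ≠ j := fun h => hj (by rw [← hm, h])
    have hmS : m ∈ S := Finset.mem_erase.2 ⟨hmj, Finset.mem_univ m⟩
    have h1 : ∑ k ∈ S, c j k * (if w j = w' k then y (w j) else 0) *
        ∏ l ∈ S.erase k, (a l - c j l) = c j m * y (w j) * ∏ l ∈ S.erase m, (a l - c j l) := by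
      rw [Finset.sum_eq_single_of_mem m hmS, if_pos hm.symm]
      intro k _ hk
      rw [if_neg, mul_zero, zero_mul]
      rw [← hm]
      exact fun h => hk (w'.injective h).symm
    have h3 : a m = 0 := if_neg fun h => hmj (w.injective (h.trans hm))
    rw [h1, h2, ← Finset.mul_prod_erase S _ hmS, h3]
    ring

/-- The matrix which has the spectral determinant as an eigenvalue. -/
def spectralMatrix (z lam : ι → ℂ) (u s : ℂ) : Matrix (Equiv.Perm ι) (Equiv.Perm ι) ℂ :=
  Matrix.of fun w w' => ∏ i, ((if w i = w' i then (u - z i) * (s - lam (w i)) else 0) - 1)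

theorem spectralMatrix_apply_eq {z : ι → ℂ} (hz : Function.Injective z) (lam : ι → ℂ) {u : ℂ}
    (hu : ∀ i, u ≠ z i) (s : ℂ) (w w' : Equiv.Perm ι) :
    spectralMatrix z lam u s w w' = (∏ i, (u - z i)) *
      ((if w = w' then ∏ i, (s - lam i) else 0) - ∑ j, (u - z j)⁻¹ *
        resolventMatrix (fun i j => (z i - z j)⁻¹) (fun i => s - lam i) j w w') := by
  set c : ι → ι → ℂ := fun i j => (z i - z j)⁻¹ with hcdef
  set a : ι → ℂ := fun l => if w l = w' l then s - lam (w l) else 0 with ha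
  have hne : ∀ i j, i ≠ j → z i - z j ≠ 0 := fun i j h => sub_ne_zero.2 (hz.ne h)
  have hu' : ∀ i, u - z i ≠ 0 := fun i => sub_ne_zero.2 (hu i)
  have pf := prod_sub_add_sum_mul_prod_erase a c
    (fun i j => by simp only [hcdef, ← neg_sub (z j) (z i), inv_neg])
    (fun i j k hij hik hjk => by
      have h1 := hne _ _ hij
      have h2 := hne _ _ hik
      have h3 := hne _ _ hjk
      simp only [hcdef]
      field_simp
      ring) Finset.univ (fun i => (u - z i)⁻¹)
    (fun i _ m _ him => by
      have h1 := hne _ _ him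
      have h2 := hu' i
      have h3 := hu' m
      simp only [hcdef]
      field_simp
      ring)
  have e3 : (if w = w' then ∏ i, (s - lam i) else 0) = ∏ l, a l := by
    split_ifs with h
    · subst h
      simp [ha, Equiv.prod_comp w fun i => s - lam i]
    · obtain ⟨i, hi⟩ := not_forall.1 fun h' => h (Equiv.ext h')
      exact (Finset.prod_eq_zero (Finset.mem_univ i) (if_neg hi)).symm
  have e4 : ∀ j, resolventMatrix c (fun i => s - lam i) j w w' =
    ∏ l ∈ Finset.univ.erase j, (a l - c j l) := fun j => rfl
  simp only [e4]
  rw [e3, ← pf, add_sub_cancel_right, ← Finset.prod_mul_distrib, spectralMatrix, Matrix.of_apply]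
  refine Finset.prod_congr rfl fun i _ => ?_
  rw [mul_sub (u - z i) (a i), mul_inv_cancel₀ (hu' i)]
  simp [ha]

end

section

open Matrix

variable {ι : Type*} [Fintype ι] [DecidableEq ι]

/-- The spectral determinant of a pair of matrices. -/
noncomputable def spectralDet (X Z : Matrix ι ι ℂ) (u s : ℂ) : ℂ :=
  (scalar ι u - X).det * (scalar ι s - Z).det -
    ((scalar ι s - Z).adjugate * (scalar ι u - X).adjugate * (X * Z - Z * X + 1)).trace

theorem adjugate_conj {g h : Matrix ι ι ℂ} (hgh : g * h = 1) (A : Matrix ι ι ℂ) :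
    (g * A * h).adjugate = g * A.adjugate * h := by
  have hhg : h * g = 1 := mul_eq_one_comm.1 hgh
  have e1 : h.adjugate = h.det • g := by
    rw [← mul_one h.adjugate, ← hhg, ← mul_assoc, adjugate_mul, smul_mul_assoc, one_mul]
  have e2 : g.adjugate = g.det • h := by
    rw [← one_mul g.adjugate, ← hhg, mul_assoc, mul_adjugate, mul_smul_comm, mul_one]
  have e3 : g.det * h.det = 1 := by rw [← det_mul, hgh, det_one]
  rw [adjugate_mul_distrib, adjugate_mul_distrib, e1, e2]
  simp only [smul_mul_assoc, mul_smul_comm, smul_smul]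
  rw [e3, one_smul, mul_assoc]

theorem spectralDet_conj {g h : Matrix ι ι ℂ} (hgh : g * h = 1) (X Z : Matrix ι ι ℂ) (u s : ℂ) :
    spectralDet (g * X * h) (g * Z * h) u s = spectralDet X Z u s := by
  have hhg : h * g = 1 := mul_eq_one_comm.1 hgh
  have e0 : ∀ A B : Matrix ι ι ℂ, (g * A * h) * (g * B * h) = g * (A * B) * h := fun A B => by
    rw [show g * A * h * (g * B * h) = g * A * (h * g) * B * h by simp only [mul_assoc], hhg]
    simp only [mul_assoc, one_mul]
  have e1 : ∀ (a : ℂ) (A : Matrix ι ι ℂ), scalar ι a - g * A * h = g * (scalar ι a - A) * h := by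
    intro a A
    rw [mul_sub, sub_mul, ← scalar_comm _ (Commute.all a), mul_assoc (scalar ι a), hgh, mul_one]
  have e2 : ∀ A : Matrix ι ι ℂ, (g * A * h).det = A.det := fun A => by
    rw [det_mul_right_comm, hgh, one_mul]
  have e3 : g * (X * Z) * h - g * (Z * X) * h + 1 = g * (X * Z - Z * X + 1) * h := by
    rw [mul_add, add_mul, mul_one, hgh, mul_sub, sub_mul]
  rw [spectralDet, e1, e1, e2, e2, adjugate_conj hgh, adjugate_conj hgh, e0, e0, e0, e3, e0,
    trace_mul_cycle, hhg, one_mul, spectralDet]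

theorem spectralDet_eq (X Z : Matrix ι ι ℂ) (u s : ℂ) (hu : (scalar ι u - X).det ≠ 0)
    (hs : (scalar ι s - Z).det ≠ 0) :
    spectralDet X Z u s = (scalar ι u - X).det * (scalar ι s - Z).det *
      (1 - ((scalar ι s - Z)⁻¹ * (scalar ι u - X)⁻¹ * (X * Z - Z * X + 1)).trace) := by
  have h : ∀ M : Matrix ι ι ℂ, M.det ≠ 0 → M.adjugate = M.det • M⁻¹ := fun M hM => by
    rw [Matrix.inv_def, smul_smul, Ring.mul_inverse_cancel _ (isUnit_iff_ne_zero.2 hM), one_smul]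
  rw [spectralDet, h _ hu, h _ hs]
  simp only [smul_mul_assoc, mul_smul_comm, trace_smul, smul_eq_mul]
  ring

theorem resolventMatrix_vecMul {z : ι → ℂ} (hz : Function.Injective z) (p lam : ι → ℂ) (s : ℂ)
    (ψ : Equiv.Perm ι → ℂ)
    (hψ : ∀ i (F : Equiv.Perm ι → ℂ), ∑ w, ψ w * (lam (w i) * F w -
      ∑ j, (z i - z j)⁻¹ * F (w * Equiv.swap i j)) = p i * ∑ w, ψ w * F w) (w' : Equiv.Perm ι) :
    (fun j => (ψ ᵥ* resolventMatrix (fun i j => (z i - z j)⁻¹) (fun i => s - lam i) j) w') ᵥ*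
      (scalar ι s - (diagonal p + of fun i j => (z i - z j)⁻¹)) =
      fun _ => (∏ i, (s - lam i)) * ψ w' := by
  set c : ι → ι → ℂ := fun i j => (z i - z j)⁻¹ with hcdef
  have hne : ∀ i j, i ≠ j → z i - z j ≠ 0 := fun i j h => sub_ne_zero.2 (hz.ne h)
  set R := resolventMatrix c (fun i => s - lam i) with hR
  ext j
  have h1 := fun w => resolventMatrix_identity c
    (fun i j => by simp only [hcdef, ← neg_sub (z j) (z i), inv_neg])
    (fun i j k hij hik hjk => by
      have h1 := hne _ _ hij
      have h2 := hne _ _ hik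
      have h3 := hne _ _ hjk
      simp only [hcdef]
      field_simp
      ring) (fun i => s - lam i) j w w'
  have h2 := hψ j fun w => R j w w'
  have h3 : ∑ w, ψ w * (if w = w' then ∏ i, (s - lam i) else 0) = (∏ i, (s - lam i)) * ψ w' := by
    simp [mul_comm]
  rw [← h3]
  simp only [← h1]
  have h4 : ∑ w, ψ w * ((s - lam (w j)) * R j w w' +
      ∑ k, c j k * R j (w * Equiv.swap j k) w' - ∑ i, c i j * R i w w') =
      s * ∑ w, ψ w * R j w w' - ∑ w, ψ w * (lam (w j) * R j w w' -
        ∑ k, c j k * R j (w * Equiv.swap j k) w') - ∑ i, (∑ w, ψ w * R i w w') * c i j := by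
    have h5 : ∑ i, (∑ w, ψ w * R i w w') * c i j = ∑ w, ψ w * ∑ i, c i j * R i w w' := by
      simp only [Finset.sum_mul, Finset.mul_sum]
      rw [Finset.sum_comm]
      exact Finset.sum_congr rfl fun w _ => Finset.sum_congr rfl fun i _ => by ring
    rw [h5, Finset.mul_sum, ← Finset.sum_sub_distrib, ← Finset.sum_sub_distrib]
    exact Finset.sum_congr rfl fun w _ => by ring
  rw [h4, h2]
  simp only [vecMul, dotProduct, Matrix.sub_apply, Matrix.add_apply, of_apply,
    scalar_apply, mul_sub, mul_add,
    Finset.sum_sub_distrib, Finset.sum_add_distrib, diagonal_apply, mul_ite, mul_zero,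
    Finset.sum_ite_eq', Finset.mem_univ, if_true]
  ring

theorem spectralMatrix_vecMul {z : ι → ℂ} (hz : Function.Injective z) (p lam : ι → ℂ) (u s : ℂ)
    (hu : ∀ i, u ≠ z i)
    (hdet : (scalar ι s - (diagonal p + of fun i j => (z i - z j)⁻¹)).det = ∏ i, (s - lam i))
    (hs : ∀ i, s ≠ lam i)
    (ψ : Equiv.Perm ι → ℂ)
    (hψ : ∀ i (F : Equiv.Perm ι → ℂ), ∑ w, ψ w * (lam (w i) * F w -
      ∑ j, (z i - z j)⁻¹ * F (w * Equiv.swap i j)) = p i * ∑ w, ψ w * F w) :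
    ψ ᵥ* spectralMatrix z lam u s =
      spectralDet (diagonal z) (diagonal p + of fun i j => (z i - z j)⁻¹) u s • ψ := by
  have hne : ∀ i j, i ≠ j → z i - z j ≠ 0 := fun i j h => sub_ne_zero.2 (hz.ne h)
  have hu0 : ∀ i, u - z i ≠ 0 := fun i => sub_ne_zero.2 (hu i)
  ext w'
  set Y := diagonal p + of fun i j => (z i - z j)⁻¹ with hY
  have hJ : diagonal z * Y - Y * diagonal z + 1 = of fun _ _ => 1 := by
    ext i j
    rcases eq_or_ne i j with rfl | h
    · simp [mul_comm]
    · have := mul_inv_cancel₀ (hne i j h)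
      simp [hY, h]
      linear_combination this
  have hD0 : (scalar ι s - Y).det ≠ 0 := by
    rw [hdet]; exact Finset.prod_ne_zero_iff.2 fun i _ => sub_ne_zero.2 (hs i)
  have hX : scalar ι u - diagonal z = diagonal fun i => u - z i := by
    rw [scalar_apply, diagonal_sub]
  have hXdet : (scalar ι u - diagonal z).det = ∏ i, (u - z i) := by rw [hX, det_diagonal]
  have hX0 : (scalar ι u - diagonal z).det ≠ 0 := by
    rw [hXdet]; exact Finset.prod_ne_zero_iff.2 fun i _ => hu0 i
  have hXinv : (scalar ι u - diagonal z)⁻¹ = diagonal fun i => (u - z i)⁻¹ := by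
    rw [hX]
    refine Matrix.inv_eq_right_inv ?_
    rw [diagonal_mul_diagonal]
    simp [hu0]
  rw [spectralDet_eq _ _ _ _ hX0 hD0, hXdet, hdet, hXinv, hJ]
  set R := resolventMatrix (fun i j => (z i - z j)⁻¹) (fun i => s - lam i)
  set r : ι → ℂ := fun j => (ψ ᵥ* R j) w' with hr
  have h1 : r ᵥ* (scalar ι s - Y) = fun _ => (∏ i, (s - lam i)) * ψ w' :=
    resolventMatrix_vecMul hz p lam s ψ hψ w'
  have h2 : r = (fun _ => (∏ i, (s - lam i)) * ψ w') ᵥ* (scalar ι s - Y)⁻¹ := by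
    rw [← h1, vecMul_vecMul, Matrix.mul_nonsing_inv _ (isUnit_iff_ne_zero.2 hD0), vecMul_one]
  have h3 : ∑ j, (u - z j)⁻¹ * r j = (∏ i, (s - lam i)) * ψ w' *
      ((scalar ι s - Y)⁻¹ * (diagonal fun i => (u - z i)⁻¹) * of fun _ _ => (1 : ℂ)).trace := by
    have hE := mul_diagonal (fun i => (u - z i)⁻¹) (scalar ι s - Y)⁻¹
    generalize (scalar ι s - Y)⁻¹ * (diagonal fun i => (u - z i)⁻¹) = E at hE
    rw [h2, Matrix.trace, Finset.mul_sum]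
    simp only [vecMul, dotProduct, diag_apply, Matrix.mul_apply, of_apply, mul_one, hE,
      Finset.mul_sum]
    rw [Finset.sum_comm]
    exact Finset.sum_congr rfl fun i _ => Finset.sum_congr rfl fun j _ => by ring
  have h4 : (ψ ᵥ* spectralMatrix z lam u s) w' =
      (∏ i, (u - z i)) * ((∏ i, (s - lam i)) * ψ w' - ∑ j, (u - z j)⁻¹ * r j) := by
    simp only [vecMul, dotProduct, spectralMatrix_apply_eq hz lam hu, hr]
    have h5 : ∑ j, (u - z j)⁻¹ * ∑ w, ψ w * R j w w' =
        ∑ w, ψ w * ∑ j, (u - z j)⁻¹ * R j w w' := by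
      simp only [Finset.mul_sum]
      rw [Finset.sum_comm]
      exact Finset.sum_congr rfl fun w _ => Finset.sum_congr rfl fun i _ => by ring
    have h3 : ∑ w, ψ w * (if w = w' then ∏ i, (s - lam i) else 0) =
      (∏ i, (s - lam i)) * ψ w' := by simp [mul_comm]
    rw [h5, ← h3, ← Finset.sum_sub_distrib, Finset.mul_sum]
    exact Finset.sum_congr rfl fun w _ => by ring
  rw [h4, h3, Pi.smul_apply, smul_eq_mul]
  ring

theorem exists_perm_functional [Nonempty ι] {z : ι → ℂ} (hz : Function.Injective z) (p : ι → ℂ)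
    {lam : ι → ℂ} (hlam : Function.Injective lam)
    (htr : ∀ k, ((diagonal p + of fun i j => (z i - z j)⁻¹) ^ k).trace = ∑ i, lam i ^ k) :
    ∃ ψ : Equiv.Perm ι → ℂ, ψ ≠ 0 ∧ ∀ i (F : Equiv.Perm ι → ℂ), ∑ w, ψ w * (lam (w i) * F w -
      ∑ j, (z i - z j)⁻¹ * F (w * Equiv.swap i j)) = p i * ∑ w, ψ w * F w := by
  obtain ⟨ε, h1, hG, hp⟩ := exists_functional hz p
  obtain ⟨ψ, hψ⟩ := functional_eq_sum_perm ε hlam fun k h => by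
    rw [hp, htr]
    simp [MvPolynomial.psum]
  refine ⟨ψ, ?_, fun i F => ?_⟩
  · rintro rfl
    simp [hψ] at h1
  · let P : MvPolynomial ι ℂ := ∑ w' : Equiv.Perm ι, MvPolynomial.C (F w') * lagrangeProd lam w'
    have hP : ∀ w : Equiv.Perm ι, MvPolynomial.aeval (lam ∘ w) P = F w := by
      intro w
      simp only [P, map_sum, map_mul, MvPolynomial.aeval_C, aeval_lagrangeProd hlam,
        DFunLike.coe_fn_eq]
      simp
    have h2 := hG i P
    simp only [hψ, gaudin_apply, map_sub, map_mul, map_sum, map_smul, MvPolynomial.aeval_X,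
      MvPolynomial.aeval_rename, Function.comp_assoc, ← Equiv.Perm.coe_mul, hP,
      Function.comp_apply, smul_eq_mul] at h2
    exact h2

/-- The spectral determinant is an eigenvalue of the matrix `spectralMatrix`. -/
theorem spectralMatrix_sub_det_eq_zero_of_diagonal [Nonempty ι] {z : ι → ℂ}
    (hz : Function.Injective z)
    (p : ι → ℂ) {lam : ι → ℂ} (hlam : Function.Injective lam) (u s : ℂ)
    (htr : ∀ k, ((diagonal p + of fun i j => (z i - z j)⁻¹) ^ k).trace = ∑ i, lam i ^ k)
    (hu : ∀ i, u ≠ z i)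
    (hdet : (scalar ι s - (diagonal p + of fun i j => (z i - z j)⁻¹)).det = ∏ i, (s - lam i))
    (hs : ∀ i, s ≠ lam i) :
    (spectralMatrix z lam u s - scalar _ (spectralDet (diagonal z)
      (diagonal p + of fun i j => (z i - z j)⁻¹) u s)).det = 0 := by
  obtain ⟨ψ, h0, hψ⟩ := exists_perm_functional hz p hlam htr
  refine exists_vecMul_eq_zero_iff.1 ⟨ψ, h0, ?_⟩
  rw [vecMul_sub, spectralMatrix_vecMul hz p lam u s hu hdet hs ψ hψ]
  ext w
  simp [scalar_apply, mul_comm]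

end

section

open Matrix

variable {ι : Type*} [Fintype ι] [DecidableEq ι]

theorem exists_mulVec_eq_smul {X : Matrix ι ι ℂ} {μ : ℂ} (hX : X.charpoly.IsRoot μ) :
    ∃ v : ι → ℂ, v ≠ 0 ∧ X *ᵥ v = μ • v := by
  rw [Polynomial.IsRoot, eval_charpoly] at hX
  obtain ⟨v, hv, h0⟩ := exists_mulVec_eq_zero_iff.2 hX
  refine ⟨v, hv, ?_⟩
  rw [sub_mulVec, sub_eq_zero] at h0
  rw [← h0]
  ext j
  simp [scalar_apply, mulVec_diagonal]

theorem isRoot_charpoly_of_eq_prod {X : Matrix ι ι ℂ} {z : ι → ℂ}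
    (hX : X.charpoly = ∏ i, (Polynomial.X - Polynomial.C (z i))) (i : ι) :
    X.charpoly.IsRoot (z i) := by
  rw [Polynomial.IsRoot, hX, Polynomial.eval_prod]
  exact Finset.prod_eq_zero (Finset.mem_univ i) (by simp)

theorem exists_conj_diagonal {X : Matrix ι ι ℂ} {z : ι → ℂ} (hz : Function.Injective z)
    (hX : X.charpoly = ∏ i, (Polynomial.X - Polynomial.C (z i))) :
    ∃ g h : Matrix ι ι ℂ, g * h = 1 ∧ X = g * diagonal z * h := by
  choose v hv0 hv using fun i => exists_mulVec_eq_smul (isRoot_charpoly_of_eq_prod hX i)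
  have hli : LinearIndependent ℂ v :=
    Module.End.eigenvectors_linearIndependent' (toLin' X) z hz v fun i =>
      ⟨Module.End.mem_eigenspace_iff.2 (by rw [toLin'_apply, hv]), hv0 i⟩
  set g : Matrix ι ι ℂ := (of v)ᵀ with hg
  have hu : IsUnit g := linearIndependent_cols_iff_isUnit.1 hli
  have hdet : IsUnit g.det := (isUnit_iff_isUnit_det g).1 hu
  refine ⟨g, g⁻¹, mul_nonsing_inv g hdet, ?_⟩
  have h1 : X * g = g * diagonal z := by
    ext i j
    rw [mul_diagonal]
    have := congrFun (hv j) i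
    simp only [mulVec, dotProduct, Pi.smul_apply, smul_eq_mul] at this
    simp only [Matrix.mul_apply, hg, transpose_apply, of_apply]
    rw [this, mul_comm]
  rw [← h1, mul_assoc, mul_nonsing_inv g hdet, mul_one]

theorem mul_mul_pow_of_mul_eq_one {g h : Matrix ι ι ℂ} (hgh : g * h = 1) (A : Matrix ι ι ℂ)
    (k : ℕ) :
    (g * A * h) ^ k = g * A ^ k * h := by
  have hhg : h * g = 1 := mul_eq_one_comm.1 hgh
  induction k with
  | zero => simp [hgh]
  | succ k ih =>
    rw [pow_succ, ih, pow_succ]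
    rw [show g * A ^ k * h * (g * A * h) = g * A ^ k * (h * g) * A * h by simp only [mul_assoc],
      hhg, mul_one]
    simp only [mul_assoc]

theorem trace_conj {g h : Matrix ι ι ℂ} (hgh : g * h = 1) (A : Matrix ι ι ℂ) :
    (g * A * h).trace = A.trace := by
  rw [trace_mul_cycle, mul_eq_one_comm.1 hgh, one_mul]

theorem charpoly_conj {g h : Matrix ι ι ℂ} (hgh : g * h = 1) (A : Matrix ι ι ℂ) :
    (g * A * h).charpoly = A.charpoly := by
  rw [charpoly_mul_comm, ← mul_assoc, mul_eq_one_comm.1 hgh, one_mul]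

theorem spectralMatrix_sub_det_eq_zero [Nonempty ι] {X Z : Matrix ι ι ℂ} {v w : ι → ℂ}
    (hXZ : X * Z - Z * X + 1 = vecMulVec v w) {z lam : ι → ℂ} (hz : Function.Injective z)
    (hlam : Function.Injective lam)
    (hX : X.charpoly = ∏ i, (Polynomial.X - Polynomial.C (z i)))
    (hZ : Z.charpoly = ∏ i, (Polynomial.X - Polynomial.C (lam i))) {u s : ℂ}
    (hu : ∀ i, u ≠ z i) (hs : ∀ i, s ≠ lam i) :
    (spectralMatrix z lam u s - scalar _ (spectralDet X Z u s)).det = 0 := by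
  obtain ⟨g, h, hgh, rfl⟩ := exists_conj_diagonal hz hX
  have hhg : h * g = 1 := mul_eq_one_comm.1 hgh
  obtain ⟨a, b, hab, hZ'⟩ := exists_conj_diagonal hlam hZ
  set v' := h *ᵥ v with hv'
  set w' := w ᵥ* g with hw'
  have e1 : diagonal z * (h * Z * g) - (h * Z * g) * diagonal z + 1 = vecMulVec v' w' := by
    have := congrArg (fun M => h * M * g) hXZ
    simp only [mul_add, add_mul, mul_sub, sub_mul, mul_one, hhg] at this
    rw [mul_vecMulVec, vecMulVec_mul] at this
    rw [← this]
    congr 2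
    · rw [show h * (g * diagonal z * h * Z) * g = (h * g) * diagonal z * (h * Z * g) by
        simp only [mul_assoc], hhg, one_mul]
    · rw [show h * (Z * (g * diagonal z * h)) * g = h * Z * g * diagonal z * (h * g) by
        simp only [mul_assoc], hhg, mul_one]
  have e2 : ∀ i, v' i * w' i = 1 := fun i => by
    have := congrFun (congrFun e1 i) i
    simp [vecMulVec_apply, mul_comm (z i)] at this
    exact this.symm
  have e3 : diagonal v' * diagonal w' = 1 := by
    rw [diagonal_mul_diagonal]; simp [e2]
  have e4 : diagonal w' * diagonal v' = 1 := mul_eq_one_comm.1 e3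
  set g' := g * diagonal v'
  set h' := diagonal w' * h
  have hgh' : g' * h' = 1 := by
    rw [show g' * h' = g * (diagonal v' * diagonal w') * h by simp only [g', h', mul_assoc], e3,
      mul_one, hgh]
  have hhg' : h' * g' = 1 := mul_eq_one_comm.1 hgh'
  set Y := h' * Z * g' with hY
  have hZY : Z = g' * Y * h' := by
    rw [show g' * Y * h' = (g' * h') * Z * (g' * h') by simp only [hY, mul_assoc], hgh', one_mul,
      mul_one]
  have hX' : g * diagonal z * h = g' * diagonal z * h' := by
    have : diagonal v' * diagonal z * diagonal w' = diagonal z := by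
      rw [diagonal_mul_diagonal, diagonal_mul_diagonal]
      congr 1; ext i; linear_combination z i * e2 i
    rw [show g' * diagonal z * h' = g * (diagonal v' * diagonal z * diagonal w') * h by
      simp only [g', h', mul_assoc], this]
  have hYoff : ∀ i j, i ≠ j → Y i j = (z i - z j)⁻¹ := by
    intro i j hij
    have e5 : Y i j = w' i * (h * Z * g) i j * v' j := by
      rw [show Y = diagonal w' * (h * Z * g) * diagonal v' by simp only [hY, g', h', mul_assoc],
        mul_diagonal, diagonal_mul]
    have e6 := congrFun (congrFun e1 i) j
    simp [vecMulVec_apply, hij] at e6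
    refine eq_inv_of_mul_eq_one_left ?_
    rw [e5]
    linear_combination w' i * v' j * e6 + v' j * w' j * e2 i + e2 j
  have hYeq : Y = diagonal (fun i => Y i i) + of fun i j => (z i - z j)⁻¹ := by
    ext i j
    rcases eq_or_ne i j with rfl | hij
    · simp
    · simp [hij, hYoff i j hij]
  rw [hX', hZY, spectralDet_conj hgh', hYeq]
  have hYch : Y.charpoly = ∏ i, (Polynomial.X - Polynomial.C (lam i)) := by
    rw [← hZ, hZY, charpoly_conj hgh']
  apply spectralMatrix_sub_det_eq_zero_of_diagonal hz _ hlam u s _ hu _ hs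
  · intro k
    rw [← hYeq, ← trace_conj hgh', ← mul_mul_pow_of_mul_eq_one hgh', ← hZY, hZ',
      mul_mul_pow_of_mul_eq_one hab, trace_conj hab, diagonal_pow]
    simp [Matrix.trace]
  · rw [← hYeq, ← eval_charpoly, hYch, Polynomial.eval_prod]
    simp

end

section

open Matrix Kronecker

variable {ι κ α β : Type*} [Fintype ι] [DecidableEq ι] [Fintype κ] [DecidableEq κ]
  [Fintype α] [DecidableEq α] [Fintype β] [DecidableEq β]

/-- The matrix of the operator `Y ↦ A * Y - Y * B`. -/
def sylvesterMatrix (A : Matrix α α ℂ) (B : Matrix β β ℂ) : Matrix (β × α) (β × α) ℂ :=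
  (1 : Matrix β β ℂ) ⊗ₖ A - Bᵀ ⊗ₖ (1 : Matrix α α ℂ)

theorem sylvesterMatrix_mulVec (A : Matrix α α ℂ) (B : Matrix β β ℂ) (Y : Matrix α β ℂ) :
    sylvesterMatrix A B *ᵥ vec Y = vec (A * Y - Y * B) := by
  rw [sylvesterMatrix, sub_mulVec, kronecker_mulVec_vec, kronecker_mulVec_vec]
  simp

theorem sylvesterMatrix_det_ne_zero_iff (A : Matrix α α ℂ) (B : Matrix β β ℂ) :
    (sylvesterMatrix A B).det ≠ 0 ↔ IsCoprime A.charpoly B.charpoly := by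
  constructor
  · intro h
    rw [Polynomial.isCoprime_iff_aeval_ne_zero_of_isAlgClosed ℂ ℂ]
    intro μ
    by_contra! hc
    obtain ⟨hA, hB⟩ := hc
    rw [← charpoly_transpose] at hB
    simp only [Polynomial.coe_aeval_eq_eval] at hA hB
    obtain ⟨a, ha, ha'⟩ := exists_mulVec_eq_smul hA
    obtain ⟨b, hb, hb'⟩ := exists_mulVec_eq_smul hB
    rw [mulVec_transpose] at hb'
    refine h (exists_mulVec_eq_zero_iff.1 ⟨vec (vecMulVec a b), ?_, ?_⟩)
    · rw [Ne, vec_eq_zero_iff]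
      obtain ⟨i, hi⟩ := Function.ne_iff.1 ha
      obtain ⟨j, hj⟩ := Function.ne_iff.1 hb
      exact fun h0 => mul_ne_zero hi hj (congrFun (congrFun h0 i) j)
    · rw [sylvesterMatrix_mulVec, mul_vecMulVec, vecMulVec_mul, ha', hb', smul_vecMulVec,
        vecMulVec_smul, sub_self, vec_zero]
  · intro h h0
    obtain ⟨y, hy, hy0⟩ := exists_mulVec_eq_zero_iff.2 h0
    obtain ⟨Y, rfl⟩ : ∃ Y : Matrix α β ℂ, vec Y = y := ⟨of fun i j => y (j, i), rfl⟩
    rw [sylvesterMatrix_mulVec, vec_eq_zero_iff, sub_eq_zero] at hy0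
    have hp : ∀ p : Polynomial ℂ, Polynomial.aeval A p * Y = Y * Polynomial.aeval B p := fun p => by
      induction p using Polynomial.induction_on' with
      | add p q hp hq => rw [map_add, map_add, Matrix.add_mul, Matrix.mul_add, hp, hq]
      | monomial k c =>
        have : A ^ k * Y = Y * B ^ k := by
          induction k with
          | zero => simp
          | succ k ih =>
            rw [pow_succ', pow_succ', Matrix.mul_assoc, ih, ← Matrix.mul_assoc, hy0,
              Matrix.mul_assoc]
        rw [Polynomial.aeval_monomial, Polynomial.aeval_monomial, ← Algebra.smul_def,
          ← Algebra.smul_def, Matrix.smul_mul, this, Matrix.mul_smul]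
    obtain ⟨p, q, hpq⟩ := h
    have h1 := congrArg (Polynomial.aeval B) hpq
    rw [map_add, map_mul, map_mul, aeval_self_charpoly, mul_zero, add_zero, map_one] at h1
    have h2 := hp (p * A.charpoly)
    rw [map_mul, map_mul, aeval_self_charpoly, mul_zero, Matrix.zero_mul] at h2
    rw [h1, Matrix.mul_one] at h2
    exact hy (by rw [← h2, vec_zero])

/-- The solution of the Sylvester equation `A * Y - Y * B = R`. -/
noncomputable def sylvesterSolve (A : Matrix α α ℂ) (B : Matrix β β ℂ) (R : Matrix α β ℂ) :
    Matrix α β ℂ :=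
  of fun i j => ((sylvesterMatrix A B)⁻¹ *ᵥ vec R) (j, i)

theorem vec_sylvesterSolve (A : Matrix α α ℂ) (B : Matrix β β ℂ) (R : Matrix α β ℂ) :
    vec (sylvesterSolve A B R) = (sylvesterMatrix A B)⁻¹ *ᵥ vec R := rfl

theorem sylvesterSolve_spec {A : Matrix α α ℂ} {B : Matrix β β ℂ}
    (h : (sylvesterMatrix A B).det ≠ 0) (R : Matrix α β ℂ) :
    A * sylvesterSolve A B R - sylvesterSolve A B R * B = R := by
  rw [← vec_inj, ← sylvesterMatrix_mulVec, vec_sylvesterSolve, mulVec_mulVec,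
    mul_nonsing_inv _ (isUnit_iff_ne_zero.2 h), one_mulVec]

theorem sylvesterSolve_eq {A : Matrix α α ℂ} {B : Matrix β β ℂ}
    (h : (sylvesterMatrix A B).det ≠ 0) {Y R : Matrix α β ℂ} (hY : A * Y - Y * B = R) :
    sylvesterSolve A B R = Y := by
  rw [← vec_inj, ← hY, vec_sylvesterSolve, ← sylvesterMatrix_mulVec, mulVec_mulVec,
    nonsing_inv_mul _ (isUnit_iff_ne_zero.2 h), one_mulVec]

omit [Fintype α] [Fintype β] in
theorem continuous_sylvesterMatrix :
    Continuous fun p : Matrix α α ℂ × Matrix β β ℂ => sylvesterMatrix p.1 p.2 := by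
  refine continuous_matrix fun i j => ?_
  simp only [sylvesterMatrix, Matrix.sub_apply, kroneckerMap_apply, transpose_apply]
  exact (continuous_const.mul (continuous_fst.matrix_elem _ _)).sub
    ((continuous_snd.matrix_elem _ _).mul continuous_const)

theorem continuousAt_sylvesterSolve {A : Matrix α α ℂ} {B : Matrix β β ℂ} (R : Matrix α β ℂ)
    (h : (sylvesterMatrix A B).det ≠ 0) :
    ContinuousAt (fun p : Matrix α α ℂ × Matrix β β ℂ × Matrix α β ℂ =>
      sylvesterSolve p.1 p.2.1 p.2.2) (A, B, R) := by
  have hK : Continuous fun p : Matrix α α ℂ × Matrix β β ℂ × Matrix α β ℂ =>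
      sylvesterMatrix p.1 p.2.1 :=
    continuous_sylvesterMatrix.comp (continuous_fst.prodMk (continuous_fst.comp continuous_snd))
  have hform : ∀ p : Matrix α α ℂ × Matrix β β ℂ × Matrix α β ℂ,
      sylvesterSolve p.1 p.2.1 p.2.2 = (sylvesterMatrix p.1 p.2.1).det⁻¹ •
        (of fun i j => ((sylvesterMatrix p.1 p.2.1).adjugate *ᵥ vec p.2.2) (j, i) :
          Matrix α β ℂ) := fun p => by
    ext i j
    simp only [sylvesterSolve, inv_def, Ring.inverse_eq_inv', smul_mulVec, of_apply,
      Pi.smul_apply, Matrix.smul_apply]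
  simp only [hform]
  refine ContinuousAt.smul (hK.matrix_det.continuousAt.inv₀ h) (Continuous.continuousAt ?_)
  refine continuous_matrix fun i j => ?_
  have hv : Continuous fun p : Matrix α α ℂ × Matrix β β ℂ × Matrix α β ℂ => vec p.2.2 :=
    continuous_pi fun q => (continuous_snd.comp continuous_snd).matrix_elem _ _
  exact (continuous_apply (j, i)).comp (hK.matrix_adjugate.matrix_mulVec hv)

end

section

open Matrix

/-- Quadruples `(X, Z, v, w)` of two matrices, a column vector and a row vector. -/
abbrev MatrixQuadruple (ι : Type*) := Matrix ι ι ℂ × Matrix ι ι ℂ × (ι → ℂ) × (ι → ℂ)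

/-- The quadruples `(X, Z, v, w)` with `[X, Z] + 1 = v wᵀ`. -/
def calogeroMoserSet (ι : Type*) [Fintype ι] [DecidableEq ι] : Set (MatrixQuadruple ι) :=
  {T | T.1 * T.2.1 - T.2.1 * T.1 + 1 = vecMulVec T.2.2.1 T.2.2.2}

/-- The Calogero–Moser quadruples whose first matrix has simple spectrum. -/
def regularSet (ι : Type*) [Fintype ι] [DecidableEq ι] : Set (MatrixQuadruple ι) :=
  calogeroMoserSet ι ∩ {T | T.1.charpoly.Separable}

variable {ι κ α β : Type*} [Fintype ι] [DecidableEq ι] [Fintype κ] [DecidableEq κ]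
  [Fintype α] [DecidableEq α] [Fintype β] [DecidableEq β]

theorem charpoly_mul_mul_of_mul_eq_one {g : Matrix ι κ ℂ} {h : Matrix κ ι ℂ} (hgh : g * h = 1)
    (hhg : h * g = 1) (A : Matrix κ κ ℂ) : (g * A * h).charpoly = A.charpoly := by
  have h1 := charpoly_mul_comm' (g * A) h
  rw [← Matrix.mul_assoc, hhg, Matrix.one_mul] at h1
  have h2 := congrArg Polynomial.natDegree h1
  rw [Polynomial.natDegree_mul (by simp) (charpoly_monic _).ne_zero,
    Polynomial.natDegree_mul (by simp) (charpoly_monic _).ne_zero] at h2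
  have h3 : Fintype.card ι = Fintype.card κ := by
    have h4 := congrArg trace hgh
    rw [trace_mul_comm, hhg, trace_one, trace_one] at h4
    exact_mod_cast h4.symm
  rw [h3] at h1
  exact mul_left_cancel₀ (pow_ne_zero _ Polynomial.X_ne_zero) h1

/-- Change of basis for quadruples. -/
def conjQuadruple (g : Matrix ι κ ℂ) (h : Matrix κ ι ℂ) (T : MatrixQuadruple κ) :
    MatrixQuadruple ι :=
  (g * T.1 * h, g * T.2.1 * h, g *ᵥ T.2.2.1, T.2.2.2 ᵥ* h)

omit [DecidableEq ι] [DecidableEq κ] [Fintype ι] in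
theorem continuous_conjQuadruple (g : Matrix ι κ ℂ) (h : Matrix κ ι ℂ) :
    Continuous (conjQuadruple g h) := by
  unfold conjQuadruple
  fun_prop

theorem conjQuadruple_mem_calogeroMoserSet {g : Matrix ι κ ℂ} {h : Matrix κ ι ℂ}
    (hgh : g * h = 1) (hhg : h * g = 1) {T : MatrixQuadruple κ} (hT : T ∈ calogeroMoserSet κ) :
    conjQuadruple g h T ∈ calogeroMoserSet ι := by
  obtain ⟨X, Z, v, w⟩ := T
  have hT' : X * Z - Z * X + 1 = vecMulVec v w := hT
  have e : ∀ A B : Matrix κ κ ℂ, g * A * h * (g * B * h) = g * (A * B) * h := fun A B => by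
    rw [show g * A * h * (g * B * h) = g * A * (h * g) * B * h by simp only [Matrix.mul_assoc],
      hhg]
    simp only [Matrix.mul_assoc, Matrix.one_mul]
  change g * X * h * (g * Z * h) - g * Z * h * (g * X * h) + 1 = vecMulVec (g *ᵥ v) (w ᵥ* h)
  rw [e, e, ← vecMulVec_mul, ← mul_vecMulVec, ← hT', Matrix.mul_add, Matrix.add_mul,
    Matrix.mul_sub, Matrix.sub_mul, Matrix.mul_one, hgh]

theorem conjQuadruple_mem_closure {g : Matrix ι κ ℂ} {h : Matrix κ ι ℂ}
    (hgh : g * h = 1) (hhg : h * g = 1) {T : MatrixQuadruple κ} (hT : T ∈ closure (regularSet κ)) :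
    conjQuadruple g h T ∈ closure (regularSet ι) := by
  refine map_mem_closure (continuous_conjQuadruple g h) hT fun T hT => ⟨?_, ?_⟩
  · exact conjQuadruple_mem_calogeroMoserSet hgh hhg hT.1
  · change (g * T.1 * h).charpoly.Separable
    rw [charpoly_mul_mul_of_mul_eq_one hgh hhg]
    exact hT.2

/-- The quadruple assembled from two diagonal blocks, the off-diagonal blocks being determined by
the commutation relation. -/
noncomputable def blockQuadruple (p : MatrixQuadruple α × MatrixQuadruple β) :
    MatrixQuadruple (α ⊕ β) :=
  (fromBlocks p.1.1 0 0 p.2.1,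
    fromBlocks p.1.2.1 (sylvesterSolve p.1.1 p.2.1 (vecMulVec p.1.2.2.1 p.2.2.2.2))
      (sylvesterSolve p.2.1 p.1.1 (vecMulVec p.2.2.2.1 p.1.2.2.2)) p.2.2.1,
    Sum.elim p.1.2.2.1 p.2.2.2.1, Sum.elim p.1.2.2.2 p.2.2.2.2)

theorem continuousAt_blockQuadruple {p : MatrixQuadruple α × MatrixQuadruple β}
    (h₁ : (sylvesterMatrix p.1.1 p.2.1).det ≠ 0) (h₂ : (sylvesterMatrix p.2.1 p.1.1).det ≠ 0) :
    ContinuousAt blockQuadruple p := by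
  have c₁ : ContinuousAt (fun p : MatrixQuadruple α × MatrixQuadruple β =>
      sylvesterSolve p.1.1 p.2.1 (vecMulVec p.1.2.2.1 p.2.2.2.2)) p :=
    ContinuousAt.comp (f := fun p : MatrixQuadruple α × MatrixQuadruple β =>
      (p.1.1, p.2.1, vecMulVec p.1.2.2.1 p.2.2.2.2)) (continuousAt_sylvesterSolve _ h₁)
      (Continuous.continuousAt (by fun_prop))
  have c₂ : ContinuousAt (fun p : MatrixQuadruple α × MatrixQuadruple β =>
      sylvesterSolve p.2.1 p.1.1 (vecMulVec p.2.2.2.1 p.1.2.2.2)) p :=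
    ContinuousAt.comp (f := fun p : MatrixQuadruple α × MatrixQuadruple β =>
      (p.2.1, p.1.1, vecMulVec p.2.2.2.1 p.1.2.2.2)) (continuousAt_sylvesterSolve _ h₂)
      (Continuous.continuousAt (by fun_prop))
  have helim : ∀ {f : MatrixQuadruple α × MatrixQuadruple β → α → ℂ}
      {g : MatrixQuadruple α × MatrixQuadruple β → β → ℂ}, Continuous f → Continuous g →
      Continuous fun p => Sum.elim (f p) (g p) := fun hf hg => continuous_pi fun i => by
    rcases i with i | i
    · exact (continuous_apply i).comp hf
    · exact (continuous_apply i).comp hg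
  have hblocks : Continuous fun q : Matrix α α ℂ × Matrix α β ℂ × Matrix β α ℂ × Matrix β β ℂ =>
      fromBlocks q.1 q.2.1 q.2.2.1 q.2.2.2 := by fun_prop
  refine ContinuousAt.prodMk (Continuous.continuousAt (by fun_prop)) (ContinuousAt.prodMk ?_
    (ContinuousAt.prodMk ?_ ?_))
  · exact hblocks.continuousAt.comp (f := fun p : MatrixQuadruple α × MatrixQuadruple β =>
      (p.1.2.1, sylvesterSolve p.1.1 p.2.1 (vecMulVec p.1.2.2.1 p.2.2.2.2),
        sylvesterSolve p.2.1 p.1.1 (vecMulVec p.2.2.2.1 p.1.2.2.2), p.2.2.1))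
      (ContinuousAt.prodMk (Continuous.continuousAt (by fun_prop)) (c₁.prodMk (c₂.prodMk
        (Continuous.continuousAt (by fun_prop)))))
  · exact (helim (by fun_prop) (by fun_prop)).continuousAt
  · exact (helim (by fun_prop) (by fun_prop)).continuousAt

omit [Fintype α] [DecidableEq α] [Fintype β] [DecidableEq β] in
theorem vecMulVec_sumElim (v₁ w₁ : α → ℂ) (v₂ w₂ : β → ℂ) :
    vecMulVec (Sum.elim v₁ v₂) (Sum.elim w₁ w₂) = fromBlocks (vecMulVec v₁ w₁) (vecMulVec v₁ w₂)
      (vecMulVec v₂ w₁) (vecMulVec v₂ w₂) := by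
  ext (i | i) (j | j) <;> rfl

theorem mem_calogeroMoserSet_sum_iff {A : Matrix α α ℂ} {B : Matrix β β ℂ} {Z₁₁ : Matrix α α ℂ}
    {Z₁₂ : Matrix α β ℂ} {Z₂₁ : Matrix β α ℂ} {Z₂₂ : Matrix β β ℂ} {v₁ w₁ : α → ℂ}
    {v₂ w₂ : β → ℂ} :
    ((fromBlocks A 0 0 B, fromBlocks Z₁₁ Z₁₂ Z₂₁ Z₂₂, Sum.elim v₁ v₂, Sum.elim w₁ w₂) :
      MatrixQuadruple (α ⊕ β)) ∈ calogeroMoserSet (α ⊕ β) ↔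
      (A, Z₁₁, v₁, w₁) ∈ calogeroMoserSet α ∧ A * Z₁₂ - Z₁₂ * B = vecMulVec v₁ w₂ ∧
      B * Z₂₁ - Z₂₁ * A = vecMulVec v₂ w₁ ∧ (B, Z₂₂, v₂, w₂) ∈ calogeroMoserSet β := by
  simp only [calogeroMoserSet, Set.mem_ofPred_eq]
  rw [vecMulVec_sumElim, fromBlocks_multiply, fromBlocks_multiply, ← fromBlocks_one,
    sub_eq_add_neg, fromBlocks_neg, fromBlocks_add, fromBlocks_add, fromBlocks_inj]
  simp [sub_eq_add_neg]

theorem isOpen_setOf_sylvesterMatrix_det_ne_zero :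
    IsOpen {p : MatrixQuadruple α × MatrixQuadruple β |
      (sylvesterMatrix p.1.1 p.2.1).det ≠ 0 ∧ (sylvesterMatrix p.2.1 p.1.1).det ≠ 0} := by
  refine IsOpen.inter (isOpen_ne_fun (Continuous.matrix_det ?_) continuous_const)
    (isOpen_ne_fun (Continuous.matrix_det ?_) continuous_const)
  · exact continuous_sylvesterMatrix.comp (f := fun p : MatrixQuadruple α × MatrixQuadruple β =>
      (p.1.1, p.2.1)) (by fun_prop)
  · exact continuous_sylvesterMatrix.comp (f := fun p : MatrixQuadruple α × MatrixQuadruple β =>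
      (p.2.1, p.1.1)) (by fun_prop)

theorem blockQuadruple_mem_regularSet {p : MatrixQuadruple α × MatrixQuadruple β}
    (h₁ : (sylvesterMatrix p.1.1 p.2.1).det ≠ 0) (h₂ : (sylvesterMatrix p.2.1 p.1.1).det ≠ 0)
    (hp₁ : p.1 ∈ regularSet α) (hp₂ : p.2 ∈ regularSet β) :
    blockQuadruple p ∈ regularSet (α ⊕ β) := by
  refine ⟨mem_calogeroMoserSet_sum_iff.2 ⟨hp₁.1, sylvesterSolve_spec h₁ _, sylvesterSolve_spec h₂ _,
    hp₂.1⟩, ?_⟩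
  change (fromBlocks p.1.1 0 0 p.2.1).charpoly.Separable
  rw [charpoly_fromBlocks_zero₁₂]
  exact hp₁.2.mul hp₂.2 ((sylvesterMatrix_det_ne_zero_iff _ _).1 h₁)

theorem blockQuadruple_mem_closure {p : MatrixQuadruple α × MatrixQuadruple β}
    (h₁ : (sylvesterMatrix p.1.1 p.2.1).det ≠ 0) (h₂ : (sylvesterMatrix p.2.1 p.1.1).det ≠ 0)
    (hp₁ : p.1 ∈ closure (regularSet α)) (hp₂ : p.2 ∈ closure (regularSet β)) :
    blockQuadruple p ∈ closure (regularSet (α ⊕ β)) := by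
  have hcl : p ∈ closure (regularSet α ×ˢ regularSet β) := by
    rw [closure_prod_eq]
    exact ⟨hp₁, hp₂⟩
  refine (continuousAt_blockQuadruple h₁ h₂).continuousWithinAt.mem_closure
    (isOpen_setOf_sylvesterMatrix_det_ne_zero.inter_closure ⟨⟨h₁, h₂⟩, hcl⟩) ?_
  rintro q ⟨⟨k₁, k₂⟩, hq₁, hq₂⟩
  exact blockQuadruple_mem_regularSet k₁ k₂ hq₁ hq₂

theorem mem_closure_regularSet_sum (hα : calogeroMoserSet α ⊆ closure (regularSet α))
    (hβ : calogeroMoserSet β ⊆ closure (regularSet β)) {A : Matrix α α ℂ} {B : Matrix β β ℂ}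
    (hAB : IsCoprime A.charpoly B.charpoly) {T : MatrixQuadruple (α ⊕ β)}
    (hTX : T.1 = fromBlocks A 0 0 B) (hT : T ∈ calogeroMoserSet (α ⊕ β)) :
    T ∈ closure (regularSet (α ⊕ β)) := by
  obtain ⟨X, Z, v, w⟩ := T
  obtain rfl : X = fromBlocks A 0 0 B := hTX
  obtain ⟨Z₁₁, Z₁₂, Z₂₁, Z₂₂, rfl⟩ : ∃ Z₁₁ Z₁₂ Z₂₁ Z₂₂, Z = fromBlocks Z₁₁ Z₁₂ Z₂₁ Z₂₂ :=
    ⟨_, _, _, _, (fromBlocks_toBlocks Z).symm⟩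
  obtain ⟨v₁, v₂, rfl⟩ : ∃ v₁ v₂, v = Sum.elim v₁ v₂ := ⟨_, _, (Sum.elim_comp_inl_inr v).symm⟩
  obtain ⟨w₁, w₂, rfl⟩ : ∃ w₁ w₂, w = Sum.elim w₁ w₂ := ⟨_, _, (Sum.elim_comp_inl_inr w).symm⟩
  have h₁ := (sylvesterMatrix_det_ne_zero_iff A B).2 hAB
  have h₂ := (sylvesterMatrix_det_ne_zero_iff B A).2 hAB.symm
  obtain ⟨hT₁, e₁, e₂, hT₂⟩ := mem_calogeroMoserSet_sum_iff.1 hT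
  have key := blockQuadruple_mem_closure (p := ((A, Z₁₁, v₁, w₁), (B, Z₂₂, v₂, w₂))) h₁ h₂
    (hα hT₁) (hβ hT₂)
  simp only [blockQuadruple] at key
  rwa [sylvesterSolve_eq h₁ e₁, sylvesterSolve_eq h₂ e₂] at key

end

section

open Matrix

variable {ι : Type*} [Fintype ι] [DecidableEq ι]

theorem exists_conj_fromBlocks {X : Matrix ι ι ℂ} {μ ν : ℂ} (hμν : μ ≠ ν)
    (hμ : X.charpoly.IsRoot μ) (hν : X.charpoly.IsRoot ν) :
    ∃ (a b : ℕ) (g : Matrix ι (Fin a ⊕ Fin b) ℂ) (h : Matrix (Fin a ⊕ Fin b) ι ℂ)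
      (A : Matrix (Fin a) (Fin a) ℂ) (B : Matrix (Fin b) (Fin b) ℂ),
      a < Fintype.card ι ∧ b < Fintype.card ι ∧ g * h = 1 ∧ h * g = 1 ∧
        X = g * fromBlocks A 0 0 B * h ∧ IsCoprime A.charpoly B.charpoly := by
  set f : Module.End ℂ (ι → ℂ) := toLin' X with hf
  set F : Module.End ℂ (ι → ℂ) := f - μ • 1 with hF
  obtain ⟨m, hc, hm⟩ := (F.eventually_isCompl_ker_pow_range_pow.and
    (Filter.eventually_ge_atTop 1)).exists
  set U := LinearMap.ker (F ^ m)
  set W := LinearMap.range (F ^ m)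
  have hcomm : Commute f (F ^ m) :=
    Commute.pow_right ((Commute.refl f).sub_right ((Commute.one_right f).smul_right μ)) m
  have hU : ∀ x ∈ U, f x ∈ U := fun x hx => by
    have := LinearMap.congr_fun hcomm.eq x
    simp only [Module.End.mul_apply] at this
    rw [LinearMap.mem_ker] at hx ⊢
    rw [← this, hx, map_zero]
  have hW : ∀ x ∈ W, f x ∈ W := by
    rintro _ ⟨y, rfl⟩
    have := LinearMap.congr_fun hcomm.eq y
    simp only [Module.End.mul_apply] at this
    exact ⟨f y, this.symm⟩
  have hpow : ∀ (k : ℕ) (θ : ℂ) (x : ι → ℂ), f x = θ • x → (F ^ k) x = (θ - μ) ^ k • x :=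
    fun k θ x hx => by
      induction k with
      | zero => simp
      | succ k ih =>
        have hFx : F x = (θ - μ) • x := by simp [hF, hx, sub_smul]
        rw [pow_succ', Module.End.mul_apply, ih, map_smul, hFx, smul_smul, pow_succ]
  have hUθ : ∀ θ x, x ∈ U → x ≠ 0 → f x = θ • x → θ = μ := fun θ x hx hx0 hxθ => by
    have := hpow m θ x hxθ
    rw [LinearMap.mem_ker.1 hx] at this
    rcases smul_eq_zero.1 this.symm with h | h
    · exact sub_eq_zero.1 (pow_eq_zero_iff (by omega) |>.1 h)
    · exact absurd h hx0
  have hμU : ∀ x, f x = μ • x → x ∈ U := fun x hx => by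
    rw [LinearMap.mem_ker, hpow m μ x hx, sub_self, zero_pow (by omega), zero_smul]
  obtain ⟨x, hx0, hx⟩ := exists_mulVec_eq_smul hμ
  obtain ⟨y, hy0, hy⟩ := exists_mulVec_eq_smul hν
  have hUtop : U ≠ ⊤ := fun h => hμν (hUθ ν y (h ▸ Submodule.mem_top) hy0 hy).symm
  have hWtop : W ≠ ⊤ := fun h => by
    have hUW := hc.inf_eq_bot
    rw [h, inf_top_eq] at hUW
    exact hx0 ((Submodule.mem_bot ℂ).1 (hUW ▸ hμU x hx))
  have hcard : Module.finrank ℂ (ι → ℂ) = Fintype.card ι := Module.finrank_fintype_fun_eq_card ℂ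
  let e := Submodule.prodEquivOfIsCompl U W hc
  let f₁ : Module.End ℂ U := f.restrict hU
  let f₂ : Module.End ℂ W := f.restrict hW
  let b₁ := Module.finBasis ℂ U
  let b₂ := Module.finBasis ℂ W
  let b := (b₁.prod b₂).map e
  have he : ∀ p, e.symm (f (e p)) = f₁.prodMap f₂ p := fun p => by
    rw [LinearEquiv.symm_apply_eq]
    simp [e, f₁, f₂]
  have hM : LinearMap.toMatrix b b f =
      fromBlocks (LinearMap.toMatrix b₁ b₁ f₁) 0 0 (LinearMap.toMatrix b₂ b₂ f₂) := by
    rw [← LinearMap.toMatrix_prodMap]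
    ext i j
    rw [LinearMap.toMatrix_apply, LinearMap.toMatrix_apply]
    simp only [b, Module.Basis.map_apply, Module.Basis.map_repr, LinearEquiv.trans_apply, he]
  refine ⟨_, _, (Pi.basisFun ℂ ι).toMatrix b, b.toMatrix (Pi.basisFun ℂ ι),
    LinearMap.toMatrix b₁ b₁ f₁, LinearMap.toMatrix b₂ b₂ f₂, ?_, ?_, ?_, ?_, ?_, ?_⟩
  · rw [← hcard]; exact Submodule.finrank_lt hUtop
  · rw [← hcard]; exact Submodule.finrank_lt hWtop
  · rw [Module.Basis.toMatrix_mul_toMatrix, Module.Basis.toMatrix_self]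
  · rw [Module.Basis.toMatrix_mul_toMatrix, Module.Basis.toMatrix_self]
  · rw [← hM, basis_toMatrix_mul_linearMap_toMatrix_mul_basis_toMatrix,
      LinearMap.toMatrix_eq_toMatrix', hf, LinearMap.toMatrix'_toLin']
  · rw [LinearMap.charpoly_toMatrix, LinearMap.charpoly_toMatrix,
      Polynomial.isCoprime_iff_aeval_ne_zero_of_isAlgClosed ℂ ℂ]
    intro θ
    by_contra! h
    simp only [Polynomial.coe_aeval_eq_eval] at h
    obtain ⟨⟨x, hxU⟩, hx⟩ := (f₁.hasEigenvalue_iff_isRoot_charpoly θ).2 h.1 |>.exists_hasEigenvector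
    obtain ⟨⟨y, hyW⟩, hy⟩ := (f₂.hasEigenvalue_iff_isRoot_charpoly θ).2 h.2 |>.exists_hasEigenvector
    have hx' := congrArg Subtype.val hx.apply_eq_smul
    have hy' := congrArg Subtype.val hy.apply_eq_smul
    have hθ : θ = μ := hUθ θ x hxU (fun h => hx.2 (Subtype.ext h)) hx'
    have : y ∈ U ⊓ W := ⟨hμU y (hθ ▸ hy'), hyW⟩
    rw [hc.inf_eq_bot] at this
    exact hy.2 (Subtype.ext ((Submodule.mem_bot ℂ).1 this))


theorem eq_zero_of_eventually_eval_eq_zero {p : Polynomial ℂ}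
    (hp : ∀ᶠ c in nhds (0 : ℂ), p.eval c = 0) : p = 0 :=
  p.eq_zero_of_infinite_isRoot (infinite_of_mem_nhds (0 : ℂ) hp)

theorem trace_add_smul_pow_three (A B : Matrix ι ι ℂ) (c : ℂ) :
    ((A + c • B) ^ 3).trace = (A ^ 3).trace + 3 * (A * A * B).trace * c +
      3 * (A * B * B).trace * c ^ 2 + (B ^ 3).trace * c ^ 3 := by
  have e₁ : (A * B * A).trace = (A * A * B).trace := by rw [trace_mul_comm, mul_assoc]
  have e₂ : (B * A * A).trace = (A * A * B).trace := by
    rw [mul_assoc, trace_mul_comm]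
  have e₃ : (B * A * B).trace = (A * B * B).trace := by
    rw [mul_assoc, trace_mul_comm]
  have e₄ : (B * B * A).trace = (A * B * B).trace := by rw [trace_mul_comm, mul_assoc]
  simp only [pow_succ, pow_zero, one_mul, add_mul, mul_add, smul_mul_assoc, mul_smul_comm,
    trace_add, trace_smul, smul_eq_mul, e₁, e₂, e₃, e₄]
  ring

theorem trace_add_smul_pow_four (A B : Matrix ι ι ℂ) (c : ℂ) :
    ((A + c • B) ^ 4).trace = (A ^ 4).trace + 4 * (A * A * A * B).trace * c +
      (4 * (A * A * B * B).trace + 2 * (A * B * A * B).trace) * c ^ 2 +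
      4 * (A * B * B * B).trace * c ^ 3 + (B ^ 4).trace * c ^ 4 := by
  have rot : ∀ C D E F : Matrix ι ι ℂ, (C * D * E * F).trace = (D * E * F * C).trace := by
    intro C D E F
    rw [mul_assoc, mul_assoc, trace_mul_comm]
    simp only [mul_assoc]
  have e₁ := rot A A B A
  have e₂ := rot A B A A
  have e₃ := rot B A A A
  have e₄ := rot A B B A
  have e₅ := rot B B A A
  have e₆ := rot B A A B
  have e₇ := rot B A B A
  have e₈ := rot B A B B
  have e₉ := rot B B A B
  have e₁₀ := rot B B B A
  simp only [pow_succ, pow_zero, one_mul, add_mul, mul_add, smul_mul_assoc, mul_smul_comm,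
    trace_add, trace_smul, smul_eq_mul, e₁, e₂, e₃, e₄, e₅, e₆, e₇, e₈, e₉, e₁₀]
  ring

theorem trace_eq_zero_of_eventually_isNilpotent {A B : Matrix ι ι ℂ}
    (h : ∀ᶠ c in nhds (0 : ℂ), IsNilpotent (A + c • B)) :
    (A * A * B).trace = 0 ∧ 2 * (A * A * B * B).trace + (A * B * A * B).trace = 0 := by
  have hk : ∀ k : ℕ, k ≠ 0 → ∀ᶠ c in nhds (0 : ℂ), ((A + c • B) ^ k).trace = 0 := fun k hk => by
    filter_upwards [h] with c hc
    exact (isNilpotent_trace_of_isNilpotent (hc.pow_of_pos hk)).eq_zero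
  constructor
  · have := eq_zero_of_eventually_eval_eq_zero (p := Polynomial.C (A ^ 3).trace +
      Polynomial.C (3 * (A * A * B).trace) * Polynomial.X +
      Polynomial.C (3 * (A * B * B).trace) * Polynomial.X ^ 2 +
      Polynomial.C (B ^ 3).trace * Polynomial.X ^ 3) (by
        filter_upwards [hk 3 (by norm_num)] with c hc
        rw [trace_add_smul_pow_three] at hc
        simpa using hc)
    have := congrArg (fun p => Polynomial.coeff p 1) this
    simp only [Polynomial.coeff_add, Polynomial.coeff_C_mul, Polynomial.coeff_X_pow,
      Polynomial.coeff_X, Polynomial.coeff_C, Polynomial.coeff_zero] at this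
    norm_num at this
    exact this
  · have := eq_zero_of_eventually_eval_eq_zero (p := Polynomial.C (A ^ 4).trace +
      Polynomial.C (4 * (A * A * A * B).trace) * Polynomial.X +
      Polynomial.C (4 * (A * A * B * B).trace + 2 * (A * B * A * B).trace) * Polynomial.X ^ 2 +
      Polynomial.C (4 * (A * B * B * B).trace) * Polynomial.X ^ 3 +
      Polynomial.C (B ^ 4).trace * Polynomial.X ^ 4) (by
        filter_upwards [hk 4 (by norm_num)] with c hc
        rw [trace_add_smul_pow_four] at hc
        simpa using hc)
    have := congrArg (fun p => Polynomial.coeff p 2) this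
    simp only [Polynomial.coeff_add, Polynomial.coeff_C_mul, Polynomial.coeff_X_pow,
      Polynomial.coeff_X, Polynomial.coeff_C, Polynomial.coeff_zero] at this
    norm_num at this
    linear_combination this / 2

/-- The traceless part of a matrix. -/
noncomputable def tracelessPart (X : Matrix ι ι ℂ) : Matrix ι ι ℂ :=
  X - scalar ι (X.trace / Fintype.card ι)

theorem exists_isRoot_ne_of_not_isNilpotent [Nonempty ι] {X : Matrix ι ι ℂ}
    (hX : ¬ IsNilpotent (tracelessPart X)) :
    ∃ μ ν, μ ≠ ν ∧ X.charpoly.IsRoot μ ∧ X.charpoly.IsRoot ν := by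
  by_contra! hcon
  apply hX
  have hsplit : X.charpoly.Splits := IsAlgClosed.splits _
  obtain ⟨μ, hμ⟩ := IsAlgClosed.exists_root X.charpoly (by
    rw [charpoly_degree_eq_dim]; simp [Fintype.card_ne_zero])
  have hroots : X.charpoly.roots = Multiset.replicate X.charpoly.roots.card μ :=
    Multiset.eq_replicate_card.2 fun ν hν => by
      by_contra hne
      exact hcon μ ν (Ne.symm hne) hμ (Polynomial.isRoot_of_mem_roots hν)
  have hnil : IsNilpotent (X - scalar ι μ) := by
    have h := aeval_self_charpoly X
    rw [hsplit.eq_prod_roots_of_monic (charpoly_monic X), hroots, Multiset.map_replicate,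
      Multiset.prod_replicate, map_pow, map_sub, Polynomial.aeval_X, Polynomial.aeval_C] at h
    exact ⟨_, h⟩
  have htr := (isNilpotent_trace_of_isNilpotent hnil).eq_zero
  rw [trace_sub, sub_eq_zero] at htr
  have : X.trace / Fintype.card ι = μ := by
    rw [htr]
    simp [scalar_apply, trace_diagonal, Fintype.card_ne_zero]
  rwa [tracelessPart, this]


theorem tracelessPart_add_smul (X Y : Matrix ι ι ℂ) (c : ℂ) :
    tracelessPart (X + c • Y) = tracelessPart X + c • tracelessPart Y := by
  ext i j
  simp only [tracelessPart, scalar_apply, trace_add, trace_smul, diagonal_apply, Matrix.add_apply,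
    Matrix.sub_apply, Matrix.smul_apply, smul_eq_mul]
  split_ifs <;> ring

theorem commute_tracelessPart (X : Matrix ι ι ℂ) : Commute X (tracelessPart X) :=
  (Commute.refl X).sub_right (scalar_commute _ (Commute.all _) X).symm

theorem exists_commute_not_isNilpotent (hcard : 2 ≤ Fintype.card ι) {T : MatrixQuadruple ι}
    (hT : T ∈ calogeroMoserSet ι) : ∃ Y : Matrix ι ι ℂ, Commute Y T.2.1 ∧
      ∃ᶠ c in nhds (0 : ℂ), ¬ IsNilpotent (tracelessPart (T.1 + c • Y)) := by
  obtain ⟨X, Z, v, w⟩ := T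
  by_contra! hcon
  simp only [tracelessPart_add_smul] at hcon
  set A := tracelessPart X
  set B := tracelessPart Z
  have hB : Commute B Z := (commute_tracelessPart Z).symm
  have h₂ := (trace_eq_zero_of_eventually_isNilpotent (hcon Z (Commute.refl Z))).2
  have h₁ := (trace_eq_zero_of_eventually_isNilpotent (hcon (B * B) (hB.mul_left hB))).1
  have hA : IsNilpotent A := by simpa using (hcon 0 (Commute.zero_left Z)).self_of_nhds
  have hA2 : (A * A).trace = 0 := by
    rw [← sq]
    exact (isNilpotent_trace_of_isNilpotent (hA.pow_of_pos two_ne_zero)).eq_zero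
  have h₃ : (A * A * B * B).trace = 0 := by
    rw [tracelessPart, mul_sub, trace_sub, ← scalar_comm _ (Commute.all _), scalar_apply,
      ← smul_one_eq_diagonal, smul_mul_assoc, one_mul, trace_smul, hA2, smul_zero, sub_zero,
      ← mul_assoc] at h₁
    exact h₁
  rw [h₃] at h₂
  have hvw : A * B - B * A + 1 = vecMulVec v w := by
    rw [← show X * Z - Z * X + 1 = vecMulVec v w from hT]
    simp only [A, B, tracelessPart, sub_mul, mul_sub, scalar_apply, ← smul_one_eq_diagonal,
      smul_mul_assoc, mul_smul_comm, one_mul, mul_one]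
    simp only [smul_sub]
    rw [smul_comm]
    abel
  have htr : w ⬝ᵥ v = Fintype.card ι := by
    have := congrArg trace hvw
    rw [trace_add, trace_sub, trace_mul_comm, sub_self, zero_add, trace_one,
      trace_vecMulVec] at this
    rw [dotProduct_comm, ← this]
  have hsq : ((A * B - B * A) * (A * B - B * A)).trace =
      2 * (A * B * A * B).trace - 2 * (A * A * B * B).trace := by
    have e₁ : (A * B * (B * A)).trace = (A * A * B * B).trace := by
      rw [← mul_assoc, trace_mul_comm]; simp only [mul_assoc]
    have e₂ : (B * A * (A * B)).trace = (A * A * B * B).trace := by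
      rw [mul_assoc, trace_mul_comm]; simp only [mul_assoc]
    have e₃ : (B * A * (B * A)).trace = (A * B * A * B).trace := by
      rw [mul_assoc, trace_mul_comm]; simp only [mul_assoc]
    have e₄ : (A * B * (A * B)).trace = (A * B * A * B).trace := by simp only [mul_assoc]
    simp only [sub_mul, mul_sub, trace_sub, e₁, e₂, e₃, e₄]
    ring
  rw [eq_sub_of_add_eq hvw] at hsq
  simp only [sub_mul, mul_sub, one_mul, mul_one, trace_sub, trace_one, vecMulVec_mul_vecMulVec,
    trace_vecMulVec, dotProduct_smul, dotProduct_comm v w, htr, h₃, smul_eq_mul] at hsq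
  have hN : (Fintype.card ι : ℂ) * (Fintype.card ι - 1) = 0 := by linear_combination hsq + 2 * h₂
  rcases mul_eq_zero.1 hN with h | h
  · have : Fintype.card ι = 0 := by exact_mod_cast h
    omega
  · have : Fintype.card ι = 1 := by exact_mod_cast sub_eq_zero.1 h
    omega

end

section

open Matrix Filter Topology

theorem separable_charpoly_of_card_le_one {ι : Type*} [Fintype ι] [DecidableEq ι]
    (hι : Fintype.card ι ≤ 1) (X : Matrix ι ι ℂ) : X.charpoly.Separable := by
  have hdeg := charpoly_natDegree_eq_dim X
  rcases Nat.le_one_iff_eq_zero_or_eq_one.1 hι with h | h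
  · rw [h] at hdeg
    rw [(charpoly_monic X).natDegree_eq_zero.1 hdeg]
    exact Polynomial.separable_one
  · rw [h] at hdeg
    exact (Polynomial.irreducible_of_degree_eq_one
      ((Polynomial.degree_eq_iff_natDegree_eq_of_pos one_pos).2 hdeg)).separable

theorem conjQuadruple_conjQuadruple {ι κ : Type*} [Fintype ι] [DecidableEq ι] [Fintype κ]
    {g : Matrix ι κ ℂ} {h : Matrix κ ι ℂ} (hgh : g * h = 1)
    (T : MatrixQuadruple ι) : conjQuadruple g h (conjQuadruple h g T) = T := by
  have e : ∀ A : Matrix ι ι ℂ, g * (h * A * g) * h = A := fun A => by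
    rw [show g * (h * A * g) * h = (g * h) * A * (g * h) by simp only [Matrix.mul_assoc], hgh,
      Matrix.one_mul, Matrix.mul_one]
  simp only [conjQuadruple, e, mulVec_mulVec, vecMul_vecMul, hgh, one_mulVec, vecMul_one]

/-- Calogero–Moser quadruples with first matrix of simple spectrum are dense. -/
theorem calogeroMoserSet_subset_closure (ι : Type) [Fintype ι] [DecidableEq ι] :
    calogeroMoserSet ι ⊆ closure (regularSet ι) := by
  induction hn : Fintype.card ι using Nat.strong_induction_on generalizing ι with
  | _ n ih =>
    subst hn
    rcases le_or_gt (Fintype.card ι) 1 with hι | hι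
    · exact fun T hT => subset_closure ⟨hT, separable_charpoly_of_card_le_one hι _⟩
    have : Nonempty ι := Fintype.card_pos_iff.1 (by omega)
    have key : ∀ T ∈ calogeroMoserSet ι, ¬ IsNilpotent (tracelessPart T.1) →
        T ∈ closure (regularSet ι) := by
      intro T hT hnil
      obtain ⟨μ, ν, hμν, hμ, hν⟩ := exists_isRoot_ne_of_not_isNilpotent hnil
      obtain ⟨a, b, g, h, A, B, ha, hb, hgh, hhg, hX, hAB⟩ := exists_conj_fromBlocks hμν hμ hν
      rw [← conjQuadruple_conjQuadruple hgh T]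
      refine conjQuadruple_mem_closure hgh hhg (mem_closure_regularSet_sum
        (ih a ha _ (Fintype.card_fin a)) (ih b hb _ (Fintype.card_fin b)) hAB ?_
        (conjQuadruple_mem_calogeroMoserSet hhg hgh hT))
      change h * T.1 * g = _
      rw [hX, show h * (g * fromBlocks A 0 0 B * h) * g = (h * g) * fromBlocks A 0 0 B * (h * g) by
        simp only [Matrix.mul_assoc], hhg, Matrix.one_mul, Matrix.mul_one]
    intro T hT
    obtain ⟨Y, hY, hfreq⟩ := exists_commute_not_isNilpotent hι hT
    rw [← closure_closure, mem_closure_iff_frequently]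
    have hcont : Continuous fun c : ℂ => ((T.1 + c • Y, T.2) : MatrixQuadruple ι) := by fun_prop
    have htend := hcont.tendsto 0
    simp only [zero_smul, add_zero] at htend
    refine htend.frequently (hfreq.mono fun c hc => key _ ?_ hc)
    change (T.1 + c • Y) * T.2.1 - T.2.1 * (T.1 + c • Y) + 1 = _
    have hT' : T.1 * T.2.1 - T.2.1 * T.1 + 1 = vecMulVec T.2.2.1 T.2.2.2 := hT
    rw [← hT', add_mul, mul_add, smul_mul_assoc, mul_smul_comm, hY.eq, add_sub_add_right_eq_sub]

variable {ι : Type*} [Fintype ι] [DecidableEq ι]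

theorem separable_charpoly_iff (X : Matrix ι ι ℂ) :
    X.charpoly.Separable ↔ (Polynomial.aeval X X.charpoly.derivative).det ≠ 0 := by
  constructor
  · rintro ⟨a, b, hab⟩ h0
    have h := congrArg (Polynomial.aeval X) hab
    rw [map_add, map_mul, map_mul, aeval_self_charpoly, mul_zero, zero_add, map_one] at h
    have := congrArg det h
    rw [det_mul, h0, mul_zero, det_one] at this
    exact zero_ne_one this
  · intro h
    rw [Polynomial.Separable, Polynomial.isCoprime_iff_aeval_ne_zero_of_isAlgClosed ℂ ℂ]
    intro μ
    by_contra! hc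
    simp only [Polynomial.coe_aeval_eq_eval] at hc
    obtain ⟨v, hv, hXv⟩ := exists_mulVec_eq_smul hc.1
    refine h (exists_mulVec_eq_zero_iff.1 ⟨v, hv, ?_⟩)
    have hp : ∀ p : Polynomial ℂ, Polynomial.aeval X p *ᵥ v = p.eval μ • v := fun p => by
      induction p using Polynomial.induction_on' with
      | add p q hp hq => rw [map_add, add_mulVec, hp, hq, Polynomial.eval_add, add_smul]
      | monomial k c =>
        have : X ^ k *ᵥ v = μ ^ k • v := by
          induction k with
          | zero => simp
          | succ k ih => rw [pow_succ', ← mulVec_mulVec, ih, mulVec_smul, hXv, smul_smul, pow_succ]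
        rw [Polynomial.aeval_monomial, ← Algebra.smul_def, smul_mulVec, this, smul_smul,
          Polynomial.eval_monomial]
    rw [hp, hc.2, zero_smul]

theorem continuous_charpoly_coeff (k : ℕ) :
    Continuous fun X : Matrix ι ι ℂ => X.charpoly.coeff k := by
  have h : ∀ X : Matrix ι ι ℂ, X.charpoly.coeff k =
      MvPolynomial.eval (fun p : ι × ι => X p.1 p.2) ((charpoly.univ ℂ ι).coeff k) := fun X =>
    (charpoly.univ_coeff_eval₂Hom ι (RingHom.id ℂ) (fun p : ι × ι => X p.1 p.2) k).symm
  simp only [h]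
  exact (MvPolynomial.continuous_eval _).comp
    (continuous_pi fun p => continuous_id.matrix_elem _ _)

theorem isOpen_setOf_separable_charpoly :
    IsOpen {X : Matrix ι ι ℂ | X.charpoly.Separable} := by
  simp only [separable_charpoly_iff]
  refine isOpen_ne_fun (Continuous.matrix_det ?_) continuous_const
  have h : ∀ X : Matrix ι ι ℂ, Polynomial.aeval X X.charpoly.derivative =
      ∑ k ∈ Finset.range (Fintype.card ι + 1), (X.charpoly.coeff (k + 1) * (k + 1)) • X ^ k :=
    fun X => by
      rw [Polynomial.aeval_eq_sum_range' (n := Fintype.card ι + 1)]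
      · simp only [Polynomial.coeff_derivative]
      · refine (Polynomial.natDegree_derivative_le _).trans_lt ?_
        rw [charpoly_natDegree_eq_dim]
        omega
  simp only [h]
  exact continuous_finsetSum _ fun k _ =>
    ((continuous_charpoly_coeff _).mul continuous_const).smul (continuous_pow k)

end

section

open Matrix Filter Topology ComplexOrder

variable {ι : Type} [Fintype ι] [DecidableEq ι]

/-- The Calogero–Moser quadruples both of whose matrices have simple spectrum. -/
def biregularSet (ι : Type*) [Fintype ι] [DecidableEq ι] : Set (MatrixQuadruple ι) :=
  {T | T.1.charpoly.Separable} ∩ (calogeroMoserSet ι ∩ {T | T.2.1.charpoly.Separable})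

theorem calogeroMoserSet_subset_closure_biregularSet :
    calogeroMoserSet ι ⊆ closure (biregularSet ι) := by
  let τ : MatrixQuadruple ι → MatrixQuadruple ι := fun T => (T.2.1ᵀ, T.1ᵀ, T.2.2.2, T.2.2.1)
  have hτ : Continuous τ := by fun_prop
  have hτcm : ∀ T ∈ calogeroMoserSet ι, τ T ∈ calogeroMoserSet ι := fun T hT => by
    have hT' : T.1 * T.2.1 - T.2.1 * T.1 + 1 = vecMulVec T.2.2.1 T.2.2.2 := hT
    change T.2.1ᵀ * T.1ᵀ - T.1ᵀ * T.2.1ᵀ + 1 = vecMulVec T.2.2.2 T.2.2.1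
    rw [← transpose_vecMulVec, ← hT']
    simp [transpose_mul]
  have h₁ : calogeroMoserSet ι ⊆
      closure (calogeroMoserSet ι ∩ {T | T.2.1.charpoly.Separable}) := fun T hT => by
    refine map_mem_closure hτ (calogeroMoserSet_subset_closure ι (hτcm T hT)) fun S hS =>
      ⟨hτcm S hS.1, ?_⟩
    change S.1ᵀ.charpoly.Separable
    rw [charpoly_transpose]
    exact hS.2
  have h₂ : regularSet ι ⊆ closure (biregularSet ι) := fun T hT =>
    (isOpen_setOf_separable_charpoly.preimage continuous_fst).inter_closure ⟨hT.2, h₁ hT.1⟩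
  exact (calogeroMoserSet_subset_closure ι).trans (closure_minimal h₂ isClosed_closure)

theorem exists_charpoly_eq_prod (X : Matrix ι ι ℂ) :
    ∃ z : ι → ℂ, X.charpoly = ∏ i, (Polynomial.X - Polynomial.C (z i)) := by
  have hsplit : X.charpoly.Splits := IsAlgClosed.splits _
  have hcard : X.charpoly.roots.toList.length = Fintype.card ι := by
    rw [Multiset.length_toList, ← hsplit.natDegree_eq_card_roots, charpoly_natDegree_eq_dim]
  let e : ι ≃ Fin X.charpoly.roots.toList.length :=
    (Fintype.equivFin ι).trans (finCongr hcard.symm)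
  refine ⟨fun i => X.charpoly.roots.toList.get (e i), ?_⟩
  rw [e.prod_comp (fun k => Polynomial.X - Polynomial.C (X.charpoly.roots.toList.get k))]
  conv_lhs => rw [hsplit.eq_prod_roots_of_monic (charpoly_monic X), ← Multiset.coe_toList
    X.charpoly.roots]
  rw [Multiset.map_coe, Multiset.prod_coe, ← List.prod_ofFn]
  congr 1
  exact List.ext_get (by simp) (by simp)

theorem norm_le_of_isRoot_charpoly {X : Matrix ι ι ℂ} {μ : ℂ} (h : X.charpoly.IsRoot μ) :
    ‖μ‖ ≤ ∑ i, ∑ j, ‖X i j‖ := by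
  obtain ⟨v, hv, hXv⟩ := exists_mulVec_eq_smul h
  obtain ⟨k, hk⟩ := eigenvalue_mem_ball (A := X) (μ := μ)
    (Module.End.hasEigenvalue_of_hasEigenvector (x := v)
      ⟨Module.End.mem_eigenspace_iff.2 (by rw [toLin'_apply, hXv]), hv⟩)
  rw [mem_closedBall_iff_norm] at hk
  calc ‖μ‖ ≤ ‖X k k‖ + ‖μ - X k k‖ := norm_le_norm_add_norm_sub' _ _
    _ ≤ ‖X k k‖ + ∑ j ∈ Finset.univ.erase k, ‖X k j‖ := by gcongr
    _ = ∑ j, ‖X k j‖ := Finset.add_sum_erase _ (fun j => ‖X k j‖) (Finset.mem_univ k)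
    _ ≤ ∑ i, ∑ j, ‖X i j‖ := Finset.single_le_sum
        (f := fun i => ∑ j, ‖X i j‖) (fun i _ => by positivity) (Finset.mem_univ k)

/-- Along an ultrafilter, eigenvalues of a convergent family of matrices converge to the
eigenvalues of the limit. -/
theorem exists_tendsto_eigenvalues {α : Type*} {F : Ultrafilter α} {Y : α → Matrix ι ι ℂ}
    {X : Matrix ι ι ℂ} (hY : Tendsto Y F (𝓝 X)) {z : α → ι → ℂ}
    (hz : ∀ a, (Y a).charpoly = ∏ i, (Polynomial.X - Polynomial.C (z a i))) :
    ∃ z₀ : ι → ℂ, Tendsto z F (𝓝 z₀) ∧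
      X.charpoly = ∏ i, (Polynomial.X - Polynomial.C (z₀ i)) := by
  set R : ℝ := ∑ i, ∑ j, ‖X i j‖ + 1
  have hbound : ∀ᶠ a in (F : Filter α), ∑ i, ∑ j, ‖Y a i j‖ < R := by
    have hc : Continuous fun M : Matrix ι ι ℂ => ∑ i, ∑ j, ‖M i j‖ :=
      continuous_finsetSum _ fun i _ => continuous_finsetSum _ fun j _ =>
        (continuous_id.matrix_elem i j).norm
    exact ((hc.tendsto X).comp hY).eventually_lt_const (lt_add_one _)
  have hK : IsCompact (Set.pi Set.univ fun _ : ι => Metric.closedBall (0 : ℂ) R) :=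
    isCompact_univ_pi fun _ => isCompact_closedBall 0 R
  have hmem : ∀ᶠ a in (F : Filter α), z a ∈ Set.pi Set.univ fun _ : ι =>
      Metric.closedBall (0 : ℂ) R := by
    filter_upwards [hbound] with a ha i _
    rw [mem_closedBall_zero_iff]
    exact (norm_le_of_isRoot_charpoly (isRoot_charpoly_of_eq_prod (hz a) i)).trans ha.le
  obtain ⟨z₀, -, hz₀⟩ := hK.ultrafilter_le_nhds (F.map z) (by
    rw [le_principal_iff]; exact hmem)
  refine ⟨z₀, hz₀, Polynomial.funext fun t => ?_⟩
  have h₁ : Tendsto (fun a => (Y a).charpoly.eval t) F (𝓝 (X.charpoly.eval t)) := by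
    simp only [eval_charpoly]
    exact (((continuous_const.sub continuous_id).matrix_det).tendsto X).comp hY
  have h₂ : Tendsto (fun a => (Y a).charpoly.eval t) F
      (𝓝 ((∏ i, (Polynomial.X - Polynomial.C (z₀ i))).eval t)) := by
    simp only [hz, Polynomial.eval_prod, Polynomial.eval_sub, Polynomial.eval_X, Polynomial.eval_C]
    have hc : Continuous fun y : ι → ℂ => ∏ i, (t - y i) := by fun_prop
    exact (hc.tendsto z₀).comp hz₀
  exact tendsto_nhds_unique h₁ h₂

theorem injective_of_separable_charpoly {X : Matrix ι ι ℂ} {z : ι → ℂ}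
    (hX : X.charpoly = ∏ i, (Polynomial.X - Polynomial.C (z i))) (h : X.charpoly.Separable) :
    Function.Injective z := by
  rw [hX] at h
  exact Polynomial.separable_prod_X_sub_C_iff.1 h

theorem continuous_spectralDet (u s : ℂ) :
    Continuous fun p : Matrix ι ι ℂ × Matrix ι ι ℂ => spectralDet p.1 p.2 u s := by
  unfold spectralDet
  fun_prop

theorem continuous_spectralMatrix (u s : ℂ) :
    Continuous fun p : (ι → ℂ) × (ι → ℂ) => spectralMatrix p.1 p.2 u s := by
  refine continuous_matrix fun w w' => ?_
  simp only [spectralMatrix, of_apply]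
  refine continuous_finsetProd _ fun i _ => ?_
  split_ifs <;> fun_prop

theorem tendsto_comp₂ {α β γ δ : Type*} [TopologicalSpace β] [TopologicalSpace γ]
    [TopologicalSpace δ] {f : β → γ → δ} (hf : Continuous fun p : β × γ => f p.1 p.2)
    {F : Filter α} {b : α → β} {c : α → γ} {b₀ : β} {c₀ : γ} (hb : Tendsto b F (𝓝 b₀))
    (hc : Tendsto c F (𝓝 c₀)) : Tendsto (fun x => f (b x) (c x)) F (𝓝 (f b₀ c₀)) :=
  (hf.tendsto (b₀, c₀)).comp (hb.prodMk_nhds hc)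

theorem tendsto_det_sub_scalar {α κ : Type*} [Fintype κ] [DecidableEq κ] {F : Filter α}
    {M : α → Matrix κ κ ℂ} {c : α → ℂ} {M₀ : Matrix κ κ ℂ} {c₀ : ℂ} (hM : Tendsto M F (𝓝 M₀))
    (hc : Tendsto c F (𝓝 c₀)) :
    Tendsto (fun a => (M a - scalar κ (c a)).det) F (𝓝 (M₀ - scalar κ c₀).det) := by
  have h : Continuous fun p : Matrix κ κ ℂ × ℂ => (p.1 - scalar κ p.2).det := by
    refine Continuous.matrix_det (continuous_fst.sub ?_)
    simp only [scalar_apply]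
    exact (continuous_pi fun _ => continuous_snd).matrix_diagonal
  exact tendsto_comp₂ (f := fun A t => (A - scalar κ t).det) h hM hc

omit [DecidableEq ι] in
theorem eventually_forall_ne_of_tendsto {α : Type*} {F : Filter α} {g : α → ι → ℂ} {y : ι → ℂ}
    (hg : Tendsto g F (𝓝 y)) {t : ℂ} (ht : ∀ i, t ≠ y i) : ∀ᶠ a in F, ∀ i, t ≠ g a i :=
  eventually_all.2 fun i =>
    ((((continuous_apply i).tendsto _).comp hg).eventually_ne (ht i).symm).mono
      fun _ h => Ne.symm h

theorem spectralMatrix_sub_det_eq_zero_of_tendsto {α : Type*} {F : Filter α} [F.NeBot]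
    {A B : α → Matrix ι ι ℂ} {a b : α → ι → ℂ} {X Z : Matrix ι ι ℂ} {z lam : ι → ℂ}
    (hA : Tendsto A F (𝓝 X)) (hB : Tendsto B F (𝓝 Z)) (ha : Tendsto a F (𝓝 z))
    (hb : Tendsto b F (𝓝 lam)) {u s : ℂ}
    (h : ∀ᶠ x in F, (spectralMatrix (a x) (b x) u s -
      scalar _ (spectralDet (A x) (B x) u s)).det = 0) :
    (spectralMatrix z lam u s - scalar _ (spectralDet X Z u s)).det = 0 := by
  have h₁ : Tendsto (fun x => spectralMatrix (a x) (b x) u s) F (𝓝 (spectralMatrix z lam u s)) :=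
    tendsto_comp₂ (f := fun y y' => spectralMatrix y y' u s) (continuous_spectralMatrix u s) ha hb
  have h₂ : Tendsto (fun x => spectralDet (A x) (B x) u s) F (𝓝 (spectralDet X Z u s)) :=
    tendsto_comp₂ (f := fun A B => spectralDet A B u s) (continuous_spectralDet u s) hA hB
  exact tendsto_nhds_unique (tendsto_det_sub_scalar h₁ h₂) (tendsto_const_nhds.congr'
    (h.mono fun _ hx => hx.symm))

theorem exists_spectralMatrix_sub_det_eq_zero [Nonempty ι] {X Z : Matrix ι ι ℂ} {v w : ι → ℂ}
    (hXZ : X * Z - Z * X + 1 = vecMulVec v w) : ∃ z lam : ι → ℂ,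
      X.charpoly = ∏ i, (Polynomial.X - Polynomial.C (z i)) ∧
      Z.charpoly = ∏ i, (Polynomial.X - Polynomial.C (lam i)) ∧
      ∀ u s : ℂ, (∀ i, u ≠ z i) → (∀ i, s ≠ lam i) →
        (spectralMatrix z lam u s - scalar _ (spectralDet X Z u s)).det = 0 := by
  have hcl : ((X, Z, v, w) : MatrixQuadruple ι) ∈ closure (biregularSet ι) :=
    calogeroMoserSet_subset_closure_biregularSet hXZ
  obtain ⟨F, hF, hFT⟩ := mem_closure_iff_ultrafilter.1 hcl
  have tX : Tendsto (fun T : MatrixQuadruple ι => T.1) F (𝓝 X) :=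
    (continuous_fst.tendsto _).mono_left hFT
  have tZ : Tendsto (fun T : MatrixQuadruple ι => T.2.1) F (𝓝 Z) :=
    ((continuous_fst.comp continuous_snd).tendsto _).mono_left hFT
  choose ev hev using exists_charpoly_eq_prod (ι := ι)
  obtain ⟨z, tz, hz⟩ := exists_tendsto_eigenvalues tX fun T => hev T.1
  obtain ⟨lam, tlam, hlam⟩ := exists_tendsto_eigenvalues tZ fun T => hev T.2.1
  refine ⟨z, lam, hz, hlam, fun u s hu hs =>
    spectralMatrix_sub_det_eq_zero_of_tendsto tX tZ tz tlam ?_⟩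
  filter_upwards [hF, eventually_forall_ne_of_tendsto tz hu,
    eventually_forall_ne_of_tendsto tlam hs] with T hT hTu hTs
  exact spectralMatrix_sub_det_eq_zero hT.2.1
    (injective_of_separable_charpoly (hev T.1) hT.1)
    (injective_of_separable_charpoly (hev T.2.1) hT.2.2) (hev T.1) (hev T.2.1) hTu hTs

theorem im_eq_zero_of_isHermitian_sub_scalar_det_eq_zero {κ : Type*} [Fintype κ] [DecidableEq κ]
    {M : Matrix κ κ ℂ} (hM : M.IsHermitian) {c : ℂ} (h : (M - scalar κ c).det = 0) : c.im = 0 := by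
  obtain ⟨x, hx, h0⟩ := exists_mulVec_eq_zero_iff.2 h
  have hMx : M *ᵥ x = c • x := by
    rw [sub_mulVec, sub_eq_zero] at h0
    rw [h0]
    ext j
    simp [scalar_apply, mulVec_diagonal]
  have h₁ : star x ⬝ᵥ (M *ᵥ x) = c * (star x ⬝ᵥ x) := by rw [hMx, dotProduct_smul, smul_eq_mul]
  have h₂ : star c * (star x ⬝ᵥ x) = star x ⬝ᵥ (M *ᵥ x) := by
    rw [dotProduct_mulVec, ← hM.eq, ← star_mulVec, hMx, star_smul, smul_dotProduct, smul_eq_mul]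
  rw [h₁] at h₂
  exact Complex.conj_eq_iff_im.1 (mul_right_cancel₀ (dotProduct_star_self_eq_zero.not.2 hx) h₂)

theorem spectralMatrix_isHermitian {z lam : ι → ℂ} {u s : ℂ} (hz : ∀ i, (z i).im = 0)
    (hlam : ∀ i, (lam i).im = 0) (hu : u.im = 0) (hs : s.im = 0) :
    (spectralMatrix z lam u s).IsHermitian := by
  ext w w'
  simp only [spectralMatrix, conjTranspose_apply, of_apply, star_prod, star_sub, star_one]
  refine Finset.prod_congr rfl fun i _ => ?_
  have hc : ∀ {c : ℂ}, c.im = 0 → star c = c := fun h => Complex.conj_eq_iff_im.2 h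
  by_cases h : w i = w' i
  · simp only [h, if_true, star_mul', star_sub, hc hu, hc hs, hc (hz i), hc (hlam _)]
  · simp [h, Ne.symm h]

/-- The spectral determinant of a Calogero–Moser pair with real spectra is real. -/
theorem spectralDet_im_eq_zero [Nonempty ι] {X Z : Matrix ι ι ℂ} {v w : ι → ℂ}
    (hXZ : X * Z - Z * X + 1 = vecMulVec v w) (hX : ∀ z : ℂ, X.charpoly.IsRoot z → z.im = 0)
    (hZ : ∀ z : ℂ, Z.charpoly.IsRoot z → z.im = 0) {u s : ℂ} (hu : u.im = 0) (hs : s.im = 0)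
    (hXu : ¬ X.charpoly.IsRoot u) (hZs : ¬ Z.charpoly.IsRoot s) : (spectralDet X Z u s).im = 0 := by
  obtain ⟨z, lam, hz, hlam, h⟩ := exists_spectralMatrix_sub_det_eq_zero hXZ
  have rz := isRoot_charpoly_of_eq_prod hz
  have rlam := isRoot_charpoly_of_eq_prod hlam
  exact im_eq_zero_of_isHermitian_sub_scalar_det_eq_zero
    (spectralMatrix_isHermitian (fun i => hX _ (rz i)) (fun i => hZ _ (rlam i)) hu hs)
    (h u s (fun i hi => hXu (hi ▸ rz i)) fun i hi => hZs (hi ▸ rlam i))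

end

section

open Matrix Filter Topology

variable {ι : Type} [Fintype ι] [DecidableEq ι]

theorem pow_mem_of_forall_inv_mem {R : Submodule ℝ (Matrix ι ι ℂ)} {X : Matrix ι ι ℂ}
    (h : ∀ u : ℝ, (scalar ι (u : ℂ) - X).det ≠ 0 → (scalar ι (u : ℂ) - X)⁻¹ ∈ R) (a : ℕ) :
    X ^ a ∈ R := by
  have hc : Continuous fun t : ℝ => 1 - (t : ℂ) • X := by fun_prop
  have hdet : ∀ᶠ t : ℝ in 𝓝 0, (1 - (t : ℂ) • X).det ≠ 0 :=
    hc.matrix_det.continuousAt.eventually_ne (by simp)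
  have hinv : Tendsto (fun t : ℝ => (1 - (t : ℂ) • X)⁻¹) (𝓝 0) (𝓝 1) := by
    have h₁ : Tendsto (fun t : ℝ => (1 - (t : ℂ) • X).det⁻¹ • (1 - (t : ℂ) • X).adjugate) (𝓝 0)
        (𝓝 ((1 - ((0 : ℝ) : ℂ) • X).det⁻¹ • (1 - ((0 : ℝ) : ℂ) • X).adjugate)) :=
      (hc.matrix_det.continuousAt.inv₀ (by simp)).smul hc.matrix_adjugate.continuousAt
    simpa [Matrix.inv_def] using h₁
  have key : ∀ a : ℕ, (∀ᶠ t : ℝ in 𝓝[≠] 0, X ^ a * (1 - (t : ℂ) • X)⁻¹ ∈ R) → X ^ a ∈ R := by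
    intro a ha
    have hlim : Tendsto (fun t : ℝ => X ^ a * (1 - (t : ℂ) • X)⁻¹) (𝓝[≠] 0) (𝓝 (X ^ a)) := by
      simpa using (hinv.mono_left nhdsWithin_le_nhds).const_mul (X ^ a)
    exact R.closed_of_finiteDimensional.mem_of_tendsto hlim ha
  refine key a ?_
  induction a with
  | zero =>
    filter_upwards [hdet.filter_mono nhdsWithin_le_nhds, self_mem_nhdsWithin] with t ht ht0
    have ht0' : (t : ℂ) ≠ 0 := Complex.ofReal_ne_zero.2 ht0
    have e : scalar ι ((t⁻¹ : ℝ) : ℂ) - X = (t : ℂ)⁻¹ • (1 - (t : ℂ) • X) := by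
      rw [smul_sub, smul_smul, inv_mul_cancel₀ ht0', one_smul, scalar_apply, ← smul_one_eq_diagonal,
        Complex.ofReal_inv]
    have hmem := h t⁻¹ (by
      rw [e, det_smul]
      exact mul_ne_zero (pow_ne_zero _ (inv_ne_zero ht0')) ht)
    have e' : (scalar ι ((t⁻¹ : ℝ) : ℂ) - X)⁻¹ = t • (1 - (t : ℂ) • X)⁻¹ := by
      refine Matrix.inv_eq_right_inv ?_
      rw [e, ← Complex.coe_smul t, smul_mul_smul_comm, inv_mul_cancel₀ ht0', one_smul,
        mul_nonsing_inv _ (isUnit_iff_ne_zero.2 ht)]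
    rw [e'] at hmem
    rw [pow_zero, one_mul]
    exact (R.smul_mem_iff ht0).1 hmem
  | succ a ih =>
    filter_upwards [ih, hdet.filter_mono nhdsWithin_le_nhds, self_mem_nhdsWithin] with t hmem ht ht0
    have e : t • (X ^ (a + 1) * (1 - (t : ℂ) • X)⁻¹) = X ^ a * (1 - (t : ℂ) • X)⁻¹ - X ^ a := by
      have h₁ : (1 - (t : ℂ) • X) * (1 - (t : ℂ) • X)⁻¹ = 1 :=
        mul_nonsing_inv _ (isUnit_iff_ne_zero.2 ht)
      generalize (1 - (t : ℂ) • X)⁻¹ = Y at h₁ ⊢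
      rw [sub_mul, one_mul, smul_mul_assoc] at h₁
      rw [← Complex.coe_smul t, pow_succ, mul_assoc, ← mul_smul_comm, ← sub_eq_iff_eq_add'.2
        (sub_eq_iff_eq_add.1 h₁), mul_sub, mul_one]
    refine (R.smul_mem_iff ht0).1 ?_
    rw [e]
    exact R.sub_mem hmem (key a ih)

theorem det_scalar_sub_im_eq_zero {X : Matrix ι ι ℂ}
    (hX : ∀ z : ℂ, X.charpoly.IsRoot z → z.im = 0) (u : ℝ) :
    (scalar ι (u : ℂ) - X).det.im = 0 := by
  obtain ⟨z, hz⟩ := exists_charpoly_eq_prod X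
  have hr := isRoot_charpoly_of_eq_prod hz
  rw [← eval_charpoly, hz, Polynomial.eval_prod, ← Complex.conj_eq_iff_im, map_prod]
  refine Finset.prod_congr rfl fun i _ => ?_
  rw [Complex.conj_eq_iff_im]
  simp [hX _ (hr i)]

/-- The matrices `M` for which the bilinear expression `x ⬝ᵥ (A * M * B) *ᵥ y` is real. -/
def realPairing (x y : ι → ℂ) (A B : Matrix ι ι ℂ) : Submodule ℝ (Matrix ι ι ℂ) where
  carrier := {M | (x ⬝ᵥ (A * M * B) *ᵥ y).im = 0}
  add_mem' {M N} hM hN := by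
    simp only [Set.mem_ofPred_eq] at hM hN ⊢
    rw [mul_add, add_mul, add_mulVec, dotProduct_add, Complex.add_im, hM, hN, add_zero]
  zero_mem' := by simp
  smul_mem' c M hM := by
    simp only [Set.mem_ofPred_eq] at hM ⊢
    rw [mul_smul_comm, smul_mul_assoc, smul_mulVec, dotProduct_smul, Complex.smul_im, hM,
      smul_zero]

theorem mem_realPairing {x y : ι → ℂ} {A B M : Matrix ι ι ℂ} :
    M ∈ realPairing x y A B ↔ (x ⬝ᵥ (A * M * B) *ᵥ y).im = 0 := Iff.rfl

theorem dotProduct_pow_mul_pow_im_eq_zero [Nonempty ι] {X Z : Matrix ι ι ℂ} {v w : ι → ℂ}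
    (hXZ : X * Z - Z * X + 1 = vecMulVec v w) (hX : ∀ z : ℂ, X.charpoly.IsRoot z → z.im = 0)
    (hZ : ∀ z : ℂ, Z.charpoly.IsRoot z → z.im = 0) (a b : ℕ) :
    (w ⬝ᵥ (Z ^ b * X ^ a) *ᵥ v).im = 0 := by
  have h₀ : ∀ u s : ℝ, (scalar ι (u : ℂ) - X).det ≠ 0 → (scalar ι (s : ℂ) - Z).det ≠ 0 →
      (w ⬝ᵥ ((scalar ι (s : ℂ) - Z)⁻¹ * (scalar ι (u : ℂ) - X)⁻¹) *ᵥ v).im = 0 := by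
    intro u s hu hs
    have h := spectralDet_im_eq_zero hXZ hX hZ (Complex.ofReal_im u) (Complex.ofReal_im s)
      (by rwa [Polynomial.IsRoot, eval_charpoly]) (by rwa [Polynomial.IsRoot, eval_charpoly])
    have hdX := det_scalar_sub_im_eq_zero hX u
    have hdZ := det_scalar_sub_im_eq_zero hZ s
    rw [spectralDet_eq _ _ _ _ hu hs, hXZ, mul_vecMulVec, trace_vecMulVec] at h
    rw [dotProduct_comm]
    rw [← Complex.conj_eq_iff_im] at h hdX hdZ ⊢
    rw [map_mul, map_mul, hdX, hdZ] at h
    have h' := mul_left_cancel₀ (mul_ne_zero hu hs) h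
    rw [map_sub, map_one] at h'
    exact sub_right_injective h'
  have h₁ : ∀ s : ℝ, (scalar ι (s : ℂ) - Z).det ≠ 0 →
      X ^ a ∈ realPairing w v (scalar ι (s : ℂ) - Z)⁻¹ 1 := fun s hs =>
    pow_mem_of_forall_inv_mem (fun u hu => by
      rw [mem_realPairing, mul_one]
      exact h₀ u s hu hs) a
  have h₂ : Z ^ b ∈ realPairing w v 1 (X ^ a) :=
    pow_mem_of_forall_inv_mem (fun s hs => by
      have := h₁ s hs
      rw [mem_realPairing, mul_one] at this
      rwa [mem_realPairing, one_mul]) b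
  rwa [mem_realPairing, one_mul] at h₂

theorem subsingleton_of_commutator_eq_neg_one {M : Type*} [AddCommGroup M] [Module ℂ M]
    [FiniteDimensional ℂ M] {f g : Module.End ℂ M} (h : f * g - g * f + 1 = 0) :
    Subsingleton M := by
  have ht := congrArg (LinearMap.trace ℂ M) h
  rw [map_add, map_sub, LinearMap.trace_mul_comm, sub_self, zero_add, LinearMap.trace_one,
    map_zero, Nat.cast_eq_zero] at ht
  exact Module.finrank_zero_iff.1 ht

theorem mulVec_mulVec_eq_of_commutator {X Z : Matrix ι ι ℂ} {v w : ι → ℂ}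
    (hXZ : X * Z - Z * X + 1 = vecMulVec v w) (x : ι → ℂ) :
    X *ᵥ Z *ᵥ x - Z *ᵥ X *ᵥ x + x = (w ⬝ᵥ x) • v := by
  have h := congrArg (· *ᵥ x) hXZ
  simp only [add_mulVec, sub_mulVec, one_mulVec, ← mulVec_mulVec, vecMulVec_mulVec] at h
  rw [h]
  ext i
  simp [mul_comm]

theorem invariant_eq_bot {X Z : Matrix ι ι ℂ} {v w : ι → ℂ}
    (hXZ : X * Z - Z * X + 1 = vecMulVec v w) {U : Submodule ℂ (ι → ℂ)}
    (hUX : ∀ x ∈ U, X *ᵥ x ∈ U) (hUZ : ∀ x ∈ U, Z *ᵥ x ∈ U) (hUw : ∀ x ∈ U, w ⬝ᵥ x = 0) :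
    U = ⊥ := by
  have h : (toLin' X).restrict hUX * (toLin' Z).restrict hUZ -
      (toLin' Z).restrict hUZ * (toLin' X).restrict hUX + 1 = 0 := by
    ext x : 2
    have hx := mulVec_mulVec_eq_of_commutator hXZ (x : ι → ℂ)
    rw [hUw _ x.2, zero_smul] at hx
    exact hx
  have := subsingleton_of_commutator_eq_neg_one h
  exact Submodule.eq_bot_of_subsingleton

theorem invariant_eq_top {X Z : Matrix ι ι ℂ} {v w : ι → ℂ}
    (hXZ : X * Z - Z * X + 1 = vecMulVec v w) {U : Submodule ℂ (ι → ℂ)}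
    (hUX : ∀ x ∈ U, X *ᵥ x ∈ U) (hUZ : ∀ x ∈ U, Z *ᵥ x ∈ U) (hUv : v ∈ U) :
    U = ⊤ := by
  have h : U.mapQ U (toLin' X) hUX * U.mapQ U (toLin' Z) hUZ -
      U.mapQ U (toLin' Z) hUZ * U.mapQ U (toLin' X) hUX + 1 = 0 := by
    refine U.linearMap_qext (LinearMap.ext fun x => ?_)
    change U.mkQ (X *ᵥ Z *ᵥ x) - U.mkQ (Z *ᵥ X *ᵥ x) + U.mkQ x = 0
    rw [← map_sub, ← map_add, mulVec_mulVec_eq_of_commutator hXZ, map_smul, Submodule.mkQ_apply,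
      (Submodule.Quotient.mk_eq_zero U).2 hUv, smul_zero]
  exact Submodule.Quotient.subsingleton_iff.1 (subsingleton_of_commutator_eq_neg_one h)

/-- A real subspace `L` spanning `ℂ^ι` and stable under `X` and `Z` on which a functional
detecting invariant subspaces is real gives a common real form of `X` and `Z`. -/
theorem exists_units_conj_im_eq_zero {X Z : Matrix ι ι ℂ} {v w : ι → ℂ}
    (hXZ : X * Z - Z * X + 1 = vecMulVec v w) {L : Submodule ℝ (ι → ℂ)} (hv : v ∈ L)
    (hLX : ∀ x ∈ L, X *ᵥ x ∈ L) (hLZ : ∀ x ∈ L, Z *ᵥ x ∈ L) (hLw : ∀ x ∈ L, (w ⬝ᵥ x).im = 0) :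
    ∃ g : (Matrix ι ι ℂ)ˣ,
      (∀ i j, (((g : Matrix ι ι ℂ) * X * ((g⁻¹ : (Matrix ι ι ℂ)ˣ) : Matrix ι ι ℂ)) i j).im = 0) ∧
      ∀ i j, (((g : Matrix ι ι ℂ) * Z * ((g⁻¹ : (Matrix ι ι ℂ)ˣ) : Matrix ι ι ℂ)) i j).im = 0 := by
  have hbot : ∀ x ∈ L, Complex.I • x ∈ L → x = 0 := by
    let U : Submodule ℂ (ι → ℂ) :=
      { carrier := {x | x ∈ L ∧ Complex.I • x ∈ L}
        add_mem' := fun hx hy => ⟨L.add_mem hx.1 hy.1, by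
          rw [smul_add]; exact L.add_mem hx.2 hy.2⟩
        zero_mem' := ⟨L.zero_mem, by rw [smul_zero]; exact L.zero_mem⟩
        smul_mem' := fun c x hx => by
          have e₁ : c • x = c.re • x + c.im • Complex.I • x := by
            ext i
            simp only [Pi.smul_apply, Pi.add_apply, smul_eq_mul, Complex.real_smul]
            linear_combination -(x i) * Complex.re_add_im c
          have e₂ : Complex.I • c • x = c.re • Complex.I • x - c.im • x := by
            ext i
            simp only [Pi.smul_apply, Pi.sub_apply, smul_eq_mul, Complex.real_smul]
            linear_combination -(Complex.I * x i) * Complex.re_add_im c +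
              (c.im : ℂ) * x i * Complex.I_mul_I
          exact ⟨e₁ ▸ L.add_mem (L.smul_mem _ hx.1) (L.smul_mem _ hx.2),
            e₂ ▸ L.sub_mem (L.smul_mem _ hx.2) (L.smul_mem _ hx.1)⟩ }
    have hU : U = ⊥ := invariant_eq_bot hXZ
      (fun x hx => ⟨hLX _ hx.1, mulVec_smul X Complex.I x ▸ hLX _ hx.2⟩)
      (fun x hx => ⟨hLZ _ hx.1, mulVec_smul Z Complex.I x ▸ hLZ _ hx.2⟩) fun x hx => by
        have h := hLw _ hx.2
        rw [dotProduct_smul, smul_eq_mul, Complex.I_mul_im] at h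
        exact Complex.ext h (hLw _ hx.1)
    intro x hx hx'
    have hxU : x ∈ U := ⟨hx, hx'⟩
    rwa [hU, Submodule.mem_bot] at hxU
  have hspan : Submodule.span ℂ (L : Set (ι → ℂ)) = ⊤ := by
    have hstab : ∀ {Y : Matrix ι ι ℂ}, (∀ x ∈ L, Y *ᵥ x ∈ L) →
        ∀ x ∈ Submodule.span ℂ (L : Set (ι → ℂ)), Y *ᵥ x ∈ Submodule.span ℂ (L : Set (ι → ℂ)) :=
      fun {Y} hY x hx => (Submodule.span_le (p := (Submodule.span ℂ (L : Set (ι → ℂ))).comap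
        (toLin' Y))).2 (fun y hy => Submodule.subset_span (hY y hy)) hx
    exact invariant_eq_top hXZ (hstab hLX) (hstab hLZ) (Submodule.subset_span hv)
  obtain ⟨e, he⟩ : ∃ e : Module.Basis ι ℂ (ι → ℂ), ∀ i, e i ∈ L := by
    let e₀ := Module.Basis.ofSpan (K := ℂ) hspan.ge
    have : Finite _ := Module.Finite.finite_basis e₀
    exact ⟨e₀.reindex (e₀.indexEquiv (Pi.basisFun ℂ ι)), fun i => by
      rw [Module.Basis.reindex_apply]
      exact Module.Basis.ofSpan_subset hspan.ge ⟨_, rfl⟩⟩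
  have hreal : ∀ x ∈ L, ∀ i, (e.repr x i).im = 0 := by
    intro x hx
    have h₁ : x = ∑ i, (e.repr x i).re • e i + Complex.I • ∑ i, (e.repr x i).im • e i := by
      conv_lhs => rw [← e.sum_repr x]
      rw [Finset.smul_sum, ← Finset.sum_add_distrib]
      refine Finset.sum_congr rfl fun i _ => ?_
      ext j
      simp only [Pi.smul_apply, Pi.add_apply, smul_eq_mul, Complex.real_smul]
      linear_combination -(e i j) * Complex.re_add_im (e.repr x i)
    have h₂ : ∑ i, (e.repr x i).im • e i = 0 := by
      refine hbot _ (L.sum_mem fun i _ => L.smul_mem _ (he i)) ?_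
      rw [← sub_eq_iff_eq_add'.2 h₁]
      exact L.sub_mem hx (L.sum_mem fun i _ => L.smul_mem _ (he i))
    simp only [← Complex.coe_smul] at h₂
    intro i
    exact Complex.ofReal_eq_zero.1 (Fintype.linearIndependent_iff.1 e.linearIndependent _ h₂ i)
  have hg : ∀ (Y : Matrix ι ι ℂ), e.toMatrix (Pi.basisFun ℂ ι) * Y *
      (Pi.basisFun ℂ ι).toMatrix e = LinearMap.toMatrix e e (toLin' Y) := fun Y => by
    rw [← basis_toMatrix_mul_linearMap_toMatrix_mul_basis_toMatrix (b := e) (b' := Pi.basisFun ℂ ι)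
      (c := e) (c' := Pi.basisFun ℂ ι), LinearMap.toMatrix_eq_toMatrix', LinearMap.toMatrix'_toLin']
  refine ⟨⟨e.toMatrix (Pi.basisFun ℂ ι), (Pi.basisFun ℂ ι).toMatrix e,
    e.toMatrix_mul_toMatrix_flip _, (Pi.basisFun ℂ ι).toMatrix_mul_toMatrix_flip _⟩,
    fun i j => ?_, fun i j => ?_⟩
  · change ((e.toMatrix (Pi.basisFun ℂ ι) * X * (Pi.basisFun ℂ ι).toMatrix e) i j).im = 0
    rw [hg, LinearMap.toMatrix_apply]
    exact hreal _ (hLX _ (he j)) i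
  · change ((e.toMatrix (Pi.basisFun ℂ ι) * Z * (Pi.basisFun ℂ ι).toMatrix e) i j).im = 0
    rw [hg, LinearMap.toMatrix_apply]
    exact hreal _ (hLZ _ (he j)) i

theorem exists_units_conj_im_eq_zero_of_moments {X Z : Matrix ι ι ℂ} {v w : ι → ℂ}
    (hXZ : X * Z - Z * X + 1 = vecMulVec v w)
    (h : ∀ a b : ℕ, (w ⬝ᵥ (Z ^ b * X ^ a) *ᵥ v).im = 0) :
    ∃ g : (Matrix ι ι ℂ)ˣ,
      (∀ i j, (((g : Matrix ι ι ℂ) * X * ((g⁻¹ : (Matrix ι ι ℂ)ˣ) : Matrix ι ι ℂ)) i j).im = 0) ∧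
      ∀ i j, (((g : Matrix ι ι ℂ) * Z * ((g⁻¹ : (Matrix ι ι ℂ)ˣ) : Matrix ι ι ℂ)) i j).im = 0 := by
  set L : Submodule ℝ (ι → ℂ) :=
    Submodule.span ℝ (Set.range fun p : ℕ × ℕ => (Z ^ p.2 * X ^ p.1) *ᵥ v) with hL
  have hgen : ∀ a b, (Z ^ b * X ^ a) *ᵥ v ∈ L := fun a b => Submodule.subset_span ⟨(a, b), rfl⟩
  have hv : v ∈ L := by simpa using hgen 0 0
  have hstab : ∀ {Y : Matrix ι ι ℂ}, (∀ a b, Y *ᵥ (Z ^ b * X ^ a) *ᵥ v ∈ L) →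
      ∀ x ∈ L, Y *ᵥ x ∈ L := fun {Y} hY x hx =>
    (Submodule.span_le (p := L.comap ((toLin' Y).restrictScalars ℝ))).2
      (by rintro _ ⟨p, rfl⟩; exact hY p.1 p.2) hx
  have hLZ : ∀ x ∈ L, Z *ᵥ x ∈ L := hstab fun a b => by
    rw [mulVec_mulVec, ← mul_assoc, ← pow_succ']
    exact hgen a (b + 1)
  have hLX : ∀ x ∈ L, X *ᵥ x ∈ L := hstab fun a b => by
    induction b with
    | zero =>
      rw [mulVec_mulVec, pow_zero, one_mul, ← pow_succ']
      simpa using hgen (a + 1) 0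
    | succ b ih =>
      have e := mulVec_mulVec_eq_of_commutator hXZ ((Z ^ b * X ^ a) *ᵥ v)
      rw [sub_add_eq_add_sub, sub_eq_iff_eq_add, ← eq_sub_iff_add_eq] at e
      rw [pow_succ', mul_assoc, ← mulVec_mulVec, e,
        ← Complex.conj_eq_iff_re.1 (Complex.conj_eq_iff_im.2 (h a b)), Complex.coe_smul]
      exact L.sub_mem (L.add_mem (L.smul_mem _ hv) (hLZ _ ih)) (hgen a b)
  refine exists_units_conj_im_eq_zero hXZ hv hLX hLZ fun x hx => ?_
  refine Submodule.span_induction ?_ (by simp) (fun x y _ _ hx hy => ?_) (fun c x _ hx => ?_) hx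
  · rintro _ ⟨p, rfl⟩
    exact h p.1 p.2
  · rw [dotProduct_add, Complex.add_im, hx, hy, add_zero]
  · rw [dotProduct_smul, Complex.smul_im, hx, smul_zero]

theorem exists_eq_vecMulVec_of_rank_eq_one {A : Matrix ι ι ℂ} (h : A.rank = 1) :
    ∃ v w : ι → ℂ, A = vecMulVec v w := by
  obtain ⟨v, -, hv⟩ := finrank_eq_one_iff'.1 h
  choose w hw using fun j => hv ⟨A *ᵥ Pi.single j 1, ⟨Pi.single j 1, rfl⟩⟩
  refine ⟨v, w, ?_⟩
  ext i j
  have := congrFun (congrArg Subtype.val (hw j)) i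
  simp only [mulVec_single_one] at this
  rw [vecMulVec_apply, mul_comm]
  exact this.symm

end

/-- If `(X, Z)` is a Calogero–Moser pair (i.e. `[X,Z] + 1` has rank one) of
`n × n` complex matrices and both `X` and `Z` have only real eigenvalues, then the pair can be
simultaneously conjugated to a pair of real matrices. -/
theorem calogero_moser_real_locus (n : ℕ) (hn : 1 ≤ n)
    (X Z : Matrix (Fin n) (Fin n) ℂ)
    (hrank : (X * Z - Z * X + 1).rank = 1)
    (hX : ∀ z : ℂ, (Matrix.charpoly X).IsRoot z → z.im = 0)
    (hZ : ∀ z : ℂ, (Matrix.charpoly Z).IsRoot z → z.im = 0) :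
    ∃ g : (Matrix (Fin n) (Fin n) ℂ)ˣ,
      (∀ i j, (((g : Matrix (Fin n) (Fin n) ℂ) * X * ((g⁻¹ : (Matrix (Fin n) (Fin n) ℂ)ˣ) :
          Matrix (Fin n) (Fin n) ℂ)) i j).im = 0) ∧
      (∀ i j, (((g : Matrix (Fin n) (Fin n) ℂ) * Z * ((g⁻¹ : (Matrix (Fin n) (Fin n) ℂ)ˣ) :
          Matrix (Fin n) (Fin n) ℂ)) i j).im = 0) := by
  have : Nonempty (Fin n) := ⟨⟨0, hn⟩⟩
  obtain ⟨v, w, hXZ⟩ := exists_eq_vecMulVec_of_rank_eq_one hrank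
  exact exists_units_conj_im_eq_zero_of_moments hXZ
    (dotProduct_pow_mul_pow_im_eq_zero hXZ hX hZ)
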